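/- arXiv:1810.10127 — 5 statements merged into one kernel-verified Lean document; each statement's English description precedes it below -/
import Mathlib

section
/- Suppose that the sequence (u_n) is given by u_n = Σ_{j=0}^{d−1} v_n^{(j)}·x_n^{d−1−j}, where d ≥ 1 is an integer, each (v_n^{(j)}) is an integer sequence with v_n^{(0)} ≥ 1 for all n and u_n ≥ 1 for all n, and as n → ∞ one has log v_n^{(0)} = O(ν^n) for some ν < λ and v_n^{(j)} = O(v_n^{(0)}) for j = 1, …, d−1, where λ = (d + 2 + √(d(d+4)))/2. Then α = p/q + Σ_{j=2}^∞ (−1)^j/x_j has irrationality exponent μ(α) = λ. -/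
/-- The set of "good rational approximations" `P/Q` (with `Q ≥ 1`) to `α` for exponent `μ`:
pairs `(P, Q)` with `0 < |α - P/Q| < 1/Q^μ`.  The irrationality exponent of `α` is the
supremum of the set of `μ` for which this set is infinite. -/
def approxSet (α μ : ℝ) : Set (ℤ × ℤ) :=
  {PQ | 1 ≤ PQ.2 ∧ 0 < |α - (PQ.1 : ℝ) / (PQ.2 : ℝ)| ∧
    |α - (PQ.1 : ℝ) / (PQ.2 : ℝ)| < 1 / (PQ.2 : ℝ) ^ μ}

section

open Filter Topology

/-- A nonnegative sequence contracting by a factor `θ < 1` up to a null error tends to zero. -/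
theorem tendsto_zero_of_le_mul_add {b δ : ℕ → ℝ} {θ : ℝ} (hθ0 : 0 ≤ θ) (hθ1 : θ < 1)
    (hb : ∀ n, 0 ≤ b n) (hδ : Tendsto δ atTop (𝓝 0))
    (h : ∀ᶠ n in atTop, b (n + 1) ≤ θ * b n + δ n) : Tendsto b atTop (𝓝 0) := by
  rw [tendsto_order]
  refine ⟨fun c hc => Eventually.of_forall fun n => hc.trans_le (hb n), fun ε hε => ?_⟩
  have hpos : 0 < (1 - θ) * (ε / 2) := by
    have : 0 < 1 - θ := by linarith
    positivity
  obtain ⟨N, hN⟩ := eventually_atTop.1 (h.and (hδ.eventually (gt_mem_nhds hpos)))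
  have key : ∀ i, b (N + i) - ε / 2 ≤ θ ^ i * |b N - ε / 2| := by
    intro i
    induction i with
    | zero => simpa using le_abs_self (b N - ε / 2)
    | succ i ih =>
      have h1 := hN (N + i) (by omega)
      have h2 := mul_le_mul_of_nonneg_left ih hθ0
      rw [pow_succ', mul_assoc, ← add_assoc]
      linarith [h1.1, h1.2]
  have hlim : Tendsto (fun i => θ ^ i * |b N - ε / 2|) atTop (𝓝 0) := by
    simpa using (tendsto_pow_atTop_nhds_zero_of_lt_one hθ0 hθ1).mul_const (|b N - ε / 2|)
  obtain ⟨M, hM⟩ := eventually_atTop.1 (hlim.eventually (gt_mem_nhds (half_pos hε)))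
  refine eventually_atTop.2 ⟨N + M, fun n hn => ?_⟩
  obtain ⟨i, rfl⟩ := Nat.exists_eq_add_of_le (show N ≤ n by omega)
  linarith [key i, hM i (by omega)]

/-- Solutions of `L (n + 2) = c * L (n + 1) - L n + f n`, with `f` growing more slowly than the
dominant root `l` of `X ^ 2 - c * X + 1`, have consecutive ratios tending to `l`. -/
theorem tendsto_ratio_of_linear_recurrence {L f : ℕ → ℝ} {c l ν K B : ℝ} (hl : 1 < l)
    (hroot : l ^ 2 - c * l + 1 = 0) (hν0 : 0 ≤ ν) (hν : ν < l) (hB : 0 ≤ B)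
    (hL0 : ∀ n, 0 < L n) (hLmono : ∀ n, L n ≤ L (n + 1)) (hLtop : Tendsto L atTop atTop)
    (hrec : ∀ n, L (n + 2) = c * L (n + 1) - L n + f n)
    (hlow : ∀ᶠ n in atTop, -B ≤ f n) (hup : ∀ᶠ n in atTop, |f n| ≤ K * ν ^ n) :
    Tendsto (fun n => L (n + 1) / L n) atTop (𝓝 l) := by
  have hl0 : 0 < l := by linarith
  have hc : c = l + l⁻¹ := by
    field_simp
    linarith
  have hinv : l⁻¹ < 1 := inv_lt_one_of_one_lt₀ hl
  set W : ℕ → ℝ := fun n => L (n + 1) - l⁻¹ * L n with hW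
  have hWrec : ∀ n, W (n + 1) = l * W n + f n := by
    intro n
    simp only [hW]
    rw [hrec n, hc]
    field_simp
    ring
  have hWL : ∀ n, (1 - l⁻¹) * L n ≤ W n := by
    intro n
    simp only [hW]
    linarith [hLmono n]
  have hWtop : Tendsto W atTop atTop :=
    tendsto_atTop_mono hWL (hLtop.const_mul_atTop (sub_pos.2 hinv))
  set e : ℝ := B / (l - 1) with he
  have hle : l * e = B + e := by
    have : l - 1 ≠ 0 := by linarith
    rw [he]
    field_simp
    ring
  have he0 : 0 ≤ e := div_nonneg hB (by linarith)
  obtain ⟨N, hN⟩ := eventually_atTop.1 (hlow.and (hWtop.eventually (eventually_gt_atTop e)))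
  have hgrow : ∀ i, l ^ i * (W N - e) ≤ W (N + i) - e := by
    intro i
    induction i with
    | zero => simp
    | succ i ih =>
      have h1 := mul_le_mul_of_nonneg_left ih hl0.le
      rw [pow_succ', mul_assoc, ← add_assoc, hWrec]
      linarith [(hN (N + i) (by omega)).1]
  have hWN : 0 < W N - e := sub_pos.2 (hN N le_rfl).2
  set C : ℝ := (W N - e) / l ^ N with hC
  have hC0 : 0 < C := by positivity
  have hLgrow : ∀ n, N ≤ n → C * l ^ n ≤ L (n + 1) := by
    intro n hn
    obtain ⟨i, rfl⟩ := Nat.exists_eq_add_of_le hn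
    have h1 : C * l ^ (N + i) = l ^ i * (W N - e) := by
      rw [hC, pow_add]
      field_simp
    have h2 : 0 ≤ l⁻¹ * L (N + i) := mul_nonneg (inv_nonneg.2 hl0.le) (hL0 _).le
    have h3 : W (N + i) = L (N + i + 1) - l⁻¹ * L (N + i) := rfl
    rw [h1]
    linarith [hgrow i]
  have hfL : Tendsto (fun n => |f n| / L (n + 1)) atTop (𝓝 0) := by
    have hlim : Tendsto (fun n : ℕ => K / C * (ν / l) ^ n) atTop (𝓝 0) := by
      simpa using (tendsto_pow_atTop_nhds_zero_of_lt_one (div_nonneg hν0 hl0.le)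
        ((div_lt_one hl0).2 hν)).const_mul (K / C)
    refine tendsto_of_tendsto_of_tendsto_of_le_of_le' tendsto_const_nhds hlim
      (Eventually.of_forall fun n => div_nonneg (abs_nonneg _) (hL0 _).le) ?_
    filter_upwards [hup, eventually_ge_atTop N] with n h1 h2
    calc |f n| / L (n + 1) ≤ (K * ν ^ n) / (C * l ^ n) :=
          div_le_div₀ ((abs_nonneg _).trans h1) h1 (by positivity) (hLgrow n h2)
      _ = K / C * (ν / l) ^ n := by
          rw [div_pow]
          field_simp
  have hcontr : ∀ n, |L (n + 1 + 1) / L (n + 1) - l| ≤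
      l⁻¹ * |L (n + 1) / L n - l| + |f n| / L (n + 1) := by
    intro n
    have h0 := hL0 n
    have h1 := hL0 (n + 1)
    have heq : L (n + 1 + 1) / L (n + 1) - l =
        (L n / L (n + 1)) * (l⁻¹ * (L (n + 1) / L n - l)) + f n / L (n + 1) := by
      rw [show n + 1 + 1 = n + 2 from rfl, hrec n, hc]
      field_simp
      ring
    have hr : L n / L (n + 1) ≤ 1 := (div_le_one h1).2 (hLmono n)
    rw [heq]
    refine (abs_add_le _ _).trans ?_
    rw [abs_mul, abs_mul, abs_div (f n), abs_of_pos h1, abs_of_pos (inv_pos.2 hl0),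
      abs_of_pos (div_pos h0 h1)]
    have : 0 ≤ l⁻¹ * |L (n + 1) / L n - l| := by positivity
    nlinarith
  have := tendsto_zero_of_le_mul_add (b := fun n => |L (n + 1) / L n - l|)
    (inv_nonneg.2 hl0.le) hinv (fun n => abs_nonneg _) hfL (Eventually.of_forall hcontr)
  have h2 := (tendsto_zero_iff_abs_tendsto_zero _).2 this
  simpa using h2.add_const l

/-- Two-sided bound for an alternating series with decreasing terms. -/
theorem alternating_tsum_bounds {f : ℕ → ℝ} (hf : Antitone f)
    (hs : Summable fun i => (-1 : ℝ) ^ i * f i) :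
    f 0 - f 1 ≤ ∑' i, (-1 : ℝ) ^ i * f i ∧ ∑' i, (-1 : ℝ) ^ i * f i ≤ f 0 := by
  have ht := hs.hasSum.tendsto_sum_nat
  have h1 := hf.alternating_series_le_tendsto ht 1
  have h2 := hf.tendsto_le_alternating_series ht 0
  simp [Finset.sum_range_succ] at h1 h2
  exact ⟨by linarith, h2⟩

theorem finite_setOf_approx_of_bounded (α μ : ℝ) (hμ : 0 ≤ μ) (M : ℤ)
    (h : ∀ PQ ∈ approxSet α μ, PQ.2 ≤ M) : (approxSet α μ).Finite := by
  set R : ℤ := ⌈|α| * M + M⌉ with hR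
  refine ((Set.finite_Icc (-R) R).prod (Set.finite_Icc 1 M)).subset ?_
  rintro ⟨P, Q⟩ hPQ
  have hQM := h _ hPQ
  obtain ⟨h1, -, h3⟩ := hPQ
  simp only at h1 h3 hQM
  have hQ1 : (1 : ℝ) ≤ Q := by exact_mod_cast h1
  have hQM' : (Q : ℝ) ≤ M := by exact_mod_cast hQM
  have hQ0 : (0 : ℝ) < Q := by linarith
  have h4 : 1 / (Q : ℝ) ^ μ ≤ 1 := by
    rw [div_le_one (by positivity)]
    exact Real.one_le_rpow hQ1 hμ
  have h5 : |(P : ℝ) / Q| ≤ |α| + 1 := by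
    have := abs_sub_abs_le_abs_sub ((P : ℝ) / Q) α
    rw [abs_sub_comm] at this
    linarith
  rw [abs_div, abs_of_pos hQ0, div_le_iff₀ hQ0] at h5
  have h6 : |(P : ℝ)| ≤ R := by
    refine le_trans ?_ (Int.le_ceil _)
    nlinarith [abs_nonneg α]
  have h7 : |P| ≤ R := by exact_mod_cast h6
  exact ⟨abs_le.1 h7, h1, hQM⟩

theorem natCast_le_of_strictMono {X : ℕ → ℤ} (h : StrictMono X) (h0 : 0 ≤ X 0) (n : ℕ) :
    (n : ℤ) ≤ X n := by
  induction n with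
  | zero => simpa using h0
  | succ n ih =>
    have := h (Nat.lt_add_one n)
    push_cast
    omega

/-- A nonnegative sequence bounded by `K * ν ^ n` is bounded by a multiple of `(max 1 ν) ^ n`,
also when `ν` is negative. -/
theorem eventually_abs_le_max_one_pow {g : ℕ → ℝ} {K ν : ℝ}
    (h : ∀ᶠ n in atTop, |g n| ≤ K * ν ^ n) :
    ∀ᶠ n in atTop, |g n| ≤ |K| * max 1 ν ^ n := by
  rcases le_or_gt 0 ν with hν | hν
  · filter_upwards [h] with n hn
    refine hn.trans (mul_le_mul (le_abs_self K) ?_ (pow_nonneg hν n) (abs_nonneg K))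
    exact pow_le_pow_left₀ hν (le_max_right _ _) n
  · obtain ⟨N, hN⟩ := eventually_atTop.1 h
    have h1 := (abs_nonneg _).trans (hN N le_rfl)
    have h2 := (abs_nonneg _).trans (hN (N + 1) (by omega))
    rw [pow_succ, ← mul_assoc] at h2
    have h3 : K * ν ^ N = 0 := by nlinarith
    have hK : K = 0 := (mul_eq_zero.1 h3).resolve_right (pow_ne_zero _ hν.ne)
    filter_upwards [h] with n hn
    simpa [hK] using hn

/-- If the lower coefficients of a polynomial are dominated by the leading one, then along a
sequence tending to infinity the polynomial is comparable to its leading term. -/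
theorem eventually_leading_term_bounds {x : ℕ → ℤ} {d : ℕ} (hd : 1 ≤ d) {v : ℕ → ℕ → ℤ}
    (hx : Tendsto (fun n => (x n : ℝ)) atTop atTop) (hv0 : ∀ n, 1 ≤ n → 1 ≤ v 0 n)
    (hvj : ∀ j, 1 ≤ j → j ≤ d - 1 →
      ∃ K : ℝ, ∃ N : ℕ, ∀ n, N ≤ n → |((v j n : ℤ) : ℝ)| ≤ K * ((v 0 n : ℤ) : ℝ)) :
    ∀ᶠ n in atTop, (v 0 n * x n ^ d : ℝ) / 2 ≤
        1 + ((∑ j ∈ Finset.range d, v j n * x n ^ (d - 1 - j) : ℤ) : ℝ) * x n ∧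
      1 + ((∑ j ∈ Finset.range d, v j n * x n ^ (d - 1 - j) : ℤ) : ℝ) * x n ≤
        2 * (v 0 n * x n ^ d : ℝ) := by
  have hvj' : ∀ j, ∃ K : ℝ, ∀ᶠ n in atTop, j ∈ Finset.Ico 1 d →
      |((v j n : ℤ) : ℝ)| ≤ K * ((v 0 n : ℤ) : ℝ) := by
    intro j
    by_cases hj : j ∈ Finset.Ico 1 d
    · have hj' := Finset.mem_Ico.1 hj
      obtain ⟨K, N, h⟩ := hvj j hj'.1 (by omega)
      exact ⟨K, eventually_atTop.2 ⟨N, fun n hn _ => h n hn⟩⟩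
    · exact ⟨0, Eventually.of_forall fun n h => absurd h hj⟩
  choose K hK using hvj'
  have hall := (Finset.eventually_all (Finset.Ico 1 d)).2 fun j _ => hK j
  set S : ℝ := ∑ j ∈ Finset.Ico 1 d, K j with hS
  filter_upwards [hall, eventually_ge_atTop 1, hx.eventually (eventually_ge_atTop 4),
    hx.eventually (eventually_ge_atTop (4 * S))] with n h1 hn h4 hxS
  have hv : (1 : ℝ) ≤ v 0 n := by exact_mod_cast hv0 n hn
  have hx1 : (1 : ℝ) ≤ x n := by linarith
  obtain ⟨e, rfl⟩ : ∃ e, d = e + 1 := ⟨d - 1, by omega⟩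
  have hpow : (1 : ℝ) ≤ x n ^ e := one_le_pow₀ hx1
  have htail : |∑ j ∈ Finset.Ico 1 (e + 1), (v j n : ℝ) * x n ^ (e + 1 - 1 - j) * x n| ≤
      S * (v 0 n * x n ^ e) := by
    rw [hS, Finset.sum_mul]
    refine (Finset.abs_sum_le_sum_abs _ _).trans (Finset.sum_le_sum fun j hj => ?_)
    have hj' := Finset.mem_Ico.1 hj
    have hle : (x n : ℝ) ^ (e + 1 - 1 - j) * x n ≤ x n ^ e := by
      rw [← pow_succ]
      exact pow_le_pow_right₀ hx1 (by omega)
    have h0 : (0 : ℝ) ≤ x n ^ (e + 1 - 1 - j) * x n := by positivity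
    rw [mul_assoc, abs_mul, abs_of_nonneg h0, ← mul_assoc (K j)]
    exact mul_le_mul (h1 j hj hj) hle h0 ((abs_nonneg _).trans (h1 j hj hj))
  have hsplit : ((∑ j ∈ Finset.range (e + 1), v j n * x n ^ (e + 1 - 1 - j) : ℤ) : ℝ) * x n =
      v 0 n * x n ^ (e + 1) +
        ∑ j ∈ Finset.Ico 1 (e + 1), (v j n : ℝ) * x n ^ (e + 1 - 1 - j) * x n := by
    push_cast
    rw [Finset.sum_mul, Finset.range_eq_Ico, Finset.sum_eq_sum_Ico_succ_bot (by omega)]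
    simp [pow_succ, mul_assoc]
  have hve : (1 : ℝ) ≤ v 0 n * x n ^ e := by nlinarith
  have hbig : (v 0 n * x n ^ (e + 1) : ℝ) = (v 0 n * x n ^ e) * x n := by ring
  have htail' := abs_le.1 htail
  rw [hsplit, hbig]
  have hS4 : S * (v 0 n * x n ^ e : ℝ) ≤ (v 0 n * x n ^ e) * x n / 4 := by nlinarith
  have hone : 1 ≤ (v 0 n * x n ^ e : ℝ) * x n / 4 := by nlinarith
  constructor <;> linarith [htail'.1, htail'.2]

section Approximation

variable {α l : ℝ} {X Y P : ℕ → ℤ}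

theorem strictMono_of_mul (hX : ∀ n, 2 ≤ X n) (hY : ∀ n, 2 ≤ Y n)
    (hXY : ∀ n, X (n + 1) = X n * Y n) : StrictMono X :=
  strictMono_nat_of_lt_succ fun n => by
    rw [hXY]
    nlinarith [hX n, hY n]

theorem tendsto_log_of_strictMono (hX : ∀ n, 2 ≤ X n) (hmono : StrictMono X) :
    Tendsto (fun n => Real.log (X n)) atTop atTop := by
  refine Real.tendsto_log_atTop.comp (tendsto_atTop_mono (fun n => ?_)
    (tendsto_natCast_atTop_atTop (R := ℝ)))
  exact_mod_cast natCast_le_of_strictMono hmono (by linarith [hX 0]) n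

theorem log_pos_of_two_le (hX : ∀ n, 2 ≤ X n) (n : ℕ) : 0 < Real.log (X n) :=
  Real.log_pos (by exact_mod_cast (by linarith [hX n] : 1 < X n))

/-- Approximations `P n / X n` with error at most `1 / X (n + 1)` realise every exponent below
the limit of `log X (n + 1) / log X n`. -/
theorem approxSet_infinite (hX : ∀ n, 2 ≤ X n) (hmono : StrictMono X)
    (hne : ∀ n, 0 < |α - P n / X n|) (hup : ∀ n, |α - P n / X n| ≤ 1 / X (n + 1))
    (hlim : Tendsto (fun n => Real.log (X (n + 1)) / Real.log (X n)) atTop (𝓝 l))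
    {μ : ℝ} (hμ : μ < l) : (approxSet α μ).Infinite := by
  obtain ⟨N, hN⟩ := eventually_atTop.1 (hlim.eventually (lt_mem_nhds hμ))
  refine Set.infinite_of_injective_forall_mem (f := fun n => (P (N + n), X (N + n)))
    (fun i j hij => ?_) fun n => ?_
  · have := hmono.injective (Prod.mk.inj hij).2
    omega
  · have hpos : ∀ n, (0 : ℝ) < X n := fun n => by
      exact_mod_cast (by linarith [hX n] : 0 < X n)
    refine ⟨by linarith [hX (N + n)], hne _, (hup _).trans_lt ?_⟩
    have h1 := hN (N + n) (by omega)
    rw [lt_div_iff₀ (log_pos_of_two_le hX _)] at h1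
    refine one_div_lt_one_div_of_lt (Real.rpow_pos_of_pos (hpos _) _) ?_
    rw [← Real.log_lt_log_iff (Real.rpow_pos_of_pos (hpos _) _) (hpos _),
      Real.log_rpow (hpos _)]
    exact h1

/-- Reduced approximations `P n / X n` with error comparable to `1 / X (n + 1)` exclude every
exponent above the limit `l` of `log X (n + 1) / log X n`, provided `l ≤ (l - 1) ^ 2`. -/
theorem approxSet_finite (hl : 1 < l) (hl2 : l ≤ (l - 1) ^ 2)
    (hX : ∀ n, 2 ≤ X n) (hY : ∀ n, 2 ≤ Y n) (hYmono : StrictMono Y)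
    (hXY : ∀ n, X (n + 1) = X n * Y n) (hcop : ∀ n, IsCoprime (P n) (X n))
    (hup : ∀ n, |α - P n / X n| ≤ 1 / X (n + 1))
    (hlow : ∀ n, 1 / (2 * X (n + 1)) ≤ |α - P n / X n|)
    (hlim : Tendsto (fun n => Real.log (X (n + 1)) / Real.log (X n)) atTop (𝓝 l))
    {μ : ℝ} (hμ : l < μ) : (approxSet α μ).Finite := by
  have hmono := strictMono_of_mul hX hY hXY
  have htop := tendsto_log_of_strictMono hX hmono
  have hpos : ∀ n, (0 : ℝ) < X n := fun n => by
    exact_mod_cast (by linarith [hX n] : 0 < X n)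
  have hYpos : ∀ n, (0 : ℝ) < Y n := fun n => by
    exact_mod_cast (by linarith [hY n] : 0 < Y n)
  have hXY' : ∀ n, (X (n + 1) : ℝ) = X n * Y n := fun n => by exact_mod_cast hXY n
  have hlogY : ∀ n, Real.log (X (n + 1)) = Real.log (X n) + Real.log (Y n) := fun n => by
    rw [hXY', Real.log_mul (hpos n).ne' (hYpos n).ne']
  have hsmall : ∀ c : ℝ, Tendsto (fun n => c / Real.log (X n)) atTop (𝓝 0) :=
    fun c => tendsto_const_nhds.div_atTop htop
  have ev1 : ∀ᶠ n in atTop, Real.log 2 + Real.log (X (n + 1)) < μ * Real.log (X n) := by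
    have h := ((hsmall (Real.log 2)).add hlim).eventually (gt_mem_nhds (by simpa using hμ))
    filter_upwards [h] with n hn
    rwa [← add_div, div_lt_iff₀ (log_pos_of_two_le hX n)] at hn
  have ev2 : ∀ᶠ n in atTop, Real.log 2 + Real.log (X (n + 1)) <
      (μ - 1) * (Real.log (Y n) - Real.log 2) := by
    have hlt : 0 + l - (μ - 1) * (l - 1) < 0 := by nlinarith
    have h := (((hsmall (μ * Real.log 2)).add hlim).sub
      ((hlim.sub_const 1).const_mul (μ - 1))).eventually (gt_mem_nhds hlt)
    filter_upwards [h] with n hn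
    have h0 := log_pos_of_two_le hX n
    have h2 := mul_neg_of_neg_of_pos hn h0
    have h3 : (μ * Real.log 2 / Real.log (X n) + Real.log (X (n + 1)) / Real.log (X n) -
        (μ - 1) * (Real.log (X (n + 1)) / Real.log (X n) - 1)) * Real.log (X n) =
        μ * Real.log 2 + Real.log (X (n + 1)) -
          (μ - 1) * (Real.log (X (n + 1)) - Real.log (X n)) := by
      field_simp
    rw [h3, hlogY n] at h2
    rw [hlogY n]
    linarith
  obtain ⟨N, hN⟩ := eventually_atTop.1 (ev1.and ev2)
  refine finite_setOf_approx_of_bounded α μ (by linarith) (Y N) ?_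
  rintro ⟨A, Q⟩ ⟨hQ1, hA0, hA⟩
  simp only at hQ1 hA0 hA ⊢
  by_contra! hQN
  have hex : ∃ n, 2 * Q < Y n := by
    refine ⟨(2 * Q + 1).toNat, ?_⟩
    have := natCast_le_of_strictMono hYmono (by linarith [hY 0]) (2 * Q + 1).toNat
    omega
  have hleast := Nat.find_spec hex
  have hNlt : N < Nat.find hex := by
    by_contra! hle
    have := hYmono.monotone hle
    omega
  obtain ⟨n, hn⟩ : ∃ n, Nat.find hex = n + 1 := ⟨Nat.find hex - 1, by omega⟩
  have hprev : Y n ≤ 2 * Q := by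
    have := Nat.find_min hex (m := n) (by omega)
    omega
  rw [hn] at hleast
  have hQ : (0 : ℝ) < Q := by exact_mod_cast (by omega : 0 < Q)
  have hQμ : 0 < (Q : ℝ) ^ μ := Real.rpow_pos_of_pos hQ μ
  by_cases hPA : A * X (n + 1) = P (n + 1) * Q
  · have hXQ : X (n + 1) ≤ Q :=
      Int.le_of_dvd (by omega) ((hcop (n + 1)).symm.dvd_of_dvd_mul_left
        ⟨A, by rw [← hPA, mul_comm]⟩)
    have heq : (A : ℝ) / Q = P (n + 1) / X (n + 1) := by
      rw [div_eq_div_iff hQ.ne' (hpos _).ne']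
      exact_mod_cast hPA
    rw [heq] at hA
    have h1 := (hN (n + 1) (by omega)).1
    have h2 : 2 * (X (n + 1 + 1) : ℝ) < (X (n + 1) : ℝ) ^ μ := by
      rw [← Real.log_lt_log_iff (by linarith [hpos (n + 1 + 1)])
        (Real.rpow_pos_of_pos (hpos _) _), Real.log_rpow (hpos _),
        Real.log_mul two_ne_zero (hpos _).ne']
      exact h1
    have h3 : (X (n + 1) : ℝ) ^ μ ≤ (Q : ℝ) ^ μ :=
      Real.rpow_le_rpow (hpos _).le (by exact_mod_cast hXQ) (by linarith)
    have h4 := one_div_le_one_div_of_le (by linarith [hpos (n + 1 + 1)]) (h2.le.trans h3)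
    linarith [hlow (n + 1)]
  · have h1 := (hN n (by omega)).2
    have hdist : 1 / (Q * X (n + 1) : ℝ) ≤ |(P (n + 1) : ℝ) / X (n + 1) - A / Q| := by
      rw [div_sub_div _ _ (hpos _).ne' hQ.ne', abs_div,
        abs_of_pos (mul_pos (hpos (n + 1)) hQ), mul_comm (Q : ℝ)]
      refine div_le_div_of_nonneg_right ?_ (mul_pos (hpos _) hQ).le
      have : (1 : ℤ) ≤ |P (n + 1) * Q - X (n + 1) * A| :=
        Int.one_le_abs fun h => hPA (by linarith)
      exact_mod_cast this
    have hbound : 1 / (X (n + 1 + 1) : ℝ) ≤ 1 / (2 * (Q * X (n + 1))) := by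
      refine one_div_le_one_div_of_le (by have := mul_pos hQ (hpos (n + 1)); linarith) ?_
      rw [hXY' (n + 1)]
      have : (2 * Q : ℝ) ≤ Y (n + 1) := by exact_mod_cast hleast.le
      nlinarith [hpos (n + 1)]
    have h2 : 2 * (X (n + 1) : ℝ) < (Q : ℝ) ^ (μ - 1) := by
      rw [← Real.log_lt_log_iff (by linarith [hpos (n + 1)])
        (Real.rpow_pos_of_pos hQ _), Real.log_rpow hQ,
        Real.log_mul two_ne_zero (hpos _).ne']
      refine h1.trans_le (mul_le_mul_of_nonneg_left ?_ (by linarith))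
      have := Real.log_le_log (hYpos n) (by exact_mod_cast hprev : (Y n : ℝ) ≤ 2 * Q)
      rw [Real.log_mul two_ne_zero hQ.ne'] at this
      linarith
    have h3 : 2 * (Q * X (n + 1) : ℝ) ≤ (Q : ℝ) ^ μ := by
      rw [Real.rpow_sub_one hQ.ne', lt_div_iff₀ hQ] at h2
      linarith
    have h4 := one_div_le_one_div_of_le (by have := mul_pos hQ (hpos (n + 1)); linarith) h3
    have h5 := abs_sub_le ((P (n + 1) : ℝ) / X (n + 1)) α (A / Q)
    rw [abs_sub_comm _ α] at h5
    have h6 : 1 / (2 * (Q * X (n + 1)) : ℝ) = 1 / (Q * X (n + 1)) / 2 := by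
      rw [mul_comm, div_div]
    linarith [hup (n + 1)]

end Approximation

theorem convergent_determinant {a pc qc : ℕ → ℤ}
    (hpc0 : pc 0 = 0) (hpc1 : pc 1 = 1) (hqc0 : qc 0 = 1) (hqc1 : qc 1 = 0)
    (hpc : ∀ n, pc (n + 2) = a n * pc (n + 1) + pc n)
    (hqc : ∀ n, qc (n + 2) = a n * qc (n + 1) + qc n) (n : ℕ) :
    pc (n + 1) * qc n - pc n * qc (n + 1) = (-1) ^ n := by
  induction n with
  | zero => simp [hpc0, hpc1, hqc0, hqc1]
  | succ n ih =>
    rw [hpc, hqc, pow_succ, ← ih]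
    ring

theorem convergent_denominator_pos {a qc : ℕ → ℤ} {N : ℕ}
    (ha : ∀ j, 1 ≤ j → j ≤ N → 1 ≤ a j) (hqc0 : qc 0 = 1) (hqc1 : qc 1 = 0)
    (hqc : ∀ n, qc (n + 2) = a n * qc (n + 1) + qc n) (n : ℕ) (hn : n ≤ N) :
    1 ≤ qc (n + 2) ∧ 0 ≤ qc (n + 1) := by
  induction n with
  | zero => simp [hqc, hqc0, hqc1]
  | succ n ih =>
    have h := ih (by omega)
    have h1 := ha (n + 1) (by omega) hn
    refine ⟨?_, by linarith [h.1]⟩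
    rw [hqc (n + 1)]
    nlinarith [h.1, h.2]

/-- Numerators, over the denominator `x (n + 1)`, of the partial sums of the Pierce series. -/
def pierceNumerator (p : ℤ) (y : ℕ → ℤ) : ℕ → ℤ
  | 0 => p
  | n + 1 => pierceNumerator p y n * y (n + 1) + (-1) ^ n

theorem dvd_pierceNumerator {p : ℤ} {u x y : ℕ → ℤ}
    (hrec : ∀ j, 1 ≤ j → y j = y (j - 1) * (1 + u j * x j) ∧ x (j + 1) = x j * y j)
    (h0 : x 1 ∣ p * (y 0 + 1) + 1) (n : ℕ) :
    x (n + 1) ∣ pierceNumerator p y n * (y n + 1) + (-1) ^ n := by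
  induction n with
  | zero => simpa [pierceNumerator] using h0
  | succ n ih =>
    obtain ⟨c, hc⟩ := ih
    obtain ⟨hy, hx⟩ := hrec (n + 1) (by omega)
    simp only [Nat.add_sub_cancel] at hy
    refine ⟨c + pierceNumerator p y n * (y n * u (n + 1)), ?_⟩
    rw [hx, pierceNumerator, pow_succ]
    have : pierceNumerator p y n * (y (n + 1) + 1) + (-1) ^ n =
        x (n + 1) * (c + pierceNumerator p y n * (y n * u (n + 1))) := by
      rw [mul_add (x (n + 1)), ← hc, hy]
      ring
    linear_combination y (n + 1) * this

theorem isCoprime_pierceNumerator {p : ℤ} {u x y : ℕ → ℤ}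
    (hrec : ∀ j, 1 ≤ j → y j = y (j - 1) * (1 + u j * x j) ∧ x (j + 1) = x j * y j)
    (h0 : x 1 ∣ p * (y 0 + 1) + 1) (n : ℕ) :
    IsCoprime (pierceNumerator p y n) (x (n + 1)) := by
  obtain ⟨c, hc⟩ := dvd_pierceNumerator hrec h0 n
  have hs : ((-1 : ℤ) ^ n) * (-1) ^ n = 1 := by
    rw [← mul_pow]
    simp
  exact ⟨-(-1) ^ n * (y n + 1), (-1) ^ n * c, by linear_combination hs - (-1) ^ n * hc⟩

theorem pierceNumerator_div {p : ℤ} {x y : ℕ → ℤ} (hx : ∀ n, 2 ≤ x (n + 1))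
    (hy : ∀ n, 2 ≤ y (n + 1)) (hxy : ∀ n, x (n + 2) = x (n + 1) * y (n + 1)) (n : ℕ) :
    (pierceNumerator p y n : ℝ) / x (n + 1) =
      p / x 1 + ∑ j ∈ Finset.range n, (-1 : ℝ) ^ j / x (j + 2) := by
  induction n with
  | zero => simp [pierceNumerator]
  | succ n ih =>
    have h1 : (x (n + 1) : ℝ) ≠ 0 := by exact_mod_cast (by linarith [hx n] : x (n + 1) ≠ 0)
    have h2 : (y (n + 1) : ℝ) ≠ 0 := by exact_mod_cast (by linarith [hy n] : y (n + 1) ≠ 0)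
    rw [Finset.sum_range_succ, ← add_assoc, ← ih, hxy n, pierceNumerator]
    push_cast
    field_simp

/-- The error of the `n`-th partial sum of the Pierce series is comparable to `1 / x (n + 2)`. -/
theorem pierce_error_bounds {α : ℝ} {p : ℤ} {x y : ℕ → ℤ} (hx : ∀ n, 2 ≤ x (n + 1))
    (hy : ∀ n, 2 ≤ y (n + 1)) (hxy : ∀ n, x (n + 2) = x (n + 1) * y (n + 1))
    (hα : α = (p : ℝ) / x 1 + ∑' j : ℕ, (-1 : ℝ) ^ j / (x (j + 2) : ℝ)) (n : ℕ) :
    1 / (2 * x (n + 2) : ℝ) ≤ |α - pierceNumerator p y n / x (n + 1)| ∧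
      |α - pierceNumerator p y n / x (n + 1)| ≤ 1 / x (n + 2) := by
  have hpos : ∀ n, (0 : ℝ) < x (n + 1) := fun n => by
    exact_mod_cast (by linarith [hx n] : 0 < x (n + 1))
  have hdouble : ∀ n, 2 * (x (n + 1) : ℝ) ≤ x (n + 2) := fun n => by
    have : 2 * x (n + 1) ≤ x (n + 2) := by
      rw [hxy]
      nlinarith [hx n, hy n]
    exact_mod_cast this
  have hgeo : ∀ n, (2 : ℝ) ^ n ≤ x (n + 2) := by
    intro n
    induction n with
    | zero => simpa using (by exact_mod_cast (by linarith [hx 1] : (1 : ℤ) ≤ x 2) : (1 : ℝ) ≤ x 2)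
    | succ n ih =>
      rw [pow_succ]
      linarith [hdouble (n + 1)]
  have hsum : Summable fun j : ℕ => (-1 : ℝ) ^ j / (x (j + 2) : ℝ) := by
    refine Summable.of_norm_bounded summable_geometric_two fun j => ?_
    rw [norm_div, norm_pow, norm_neg, norm_one, one_pow, Real.norm_eq_abs,
      abs_of_pos (hpos (j + 1)), div_pow, one_pow]
    exact one_div_le_one_div_of_le (by positivity) (hgeo j)
  set f : ℕ → ℝ := fun i => 1 / (x (i + n + 2) : ℝ) with hf
  have hanti : Antitone f := antitone_nat_of_succ_le fun i => by
    simp only [hf]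
    have h1 := hdouble (i + n + 1)
    have h2 := hpos (i + n + 1)
    refine one_div_le_one_div_of_le h2 ?_
    rw [show i + 1 + n + 2 = i + n + 1 + 2 by ring]
    linarith
  have hterm : ∀ i, (-1 : ℝ) ^ (i + n) / (x (i + n + 2) : ℝ) = (-1) ^ n * ((-1) ^ i * f i) := by
    intro i
    simp only [hf, pow_add]
    ring
  have htail : α - pierceNumerator p y n / x (n + 1) =
      (-1 : ℝ) ^ n * ∑' i, (-1 : ℝ) ^ i * f i := by
    rw [pierceNumerator_div hx hy hxy, hα, ← hsum.sum_add_tsum_nat_add n, ← tsum_mul_left]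
    simp only [hterm]
    ring
  have hsum' : Summable fun i => (-1 : ℝ) ^ i * f i := by
    have h1 := ((summable_nat_add_iff n).2 hsum).mul_left ((-1 : ℝ) ^ n)
    refine h1.congr fun i => ?_
    rw [hterm, ← mul_assoc, ← mul_pow]
    simp
  obtain ⟨hlo, hhi⟩ := alternating_tsum_bounds hanti hsum'
  have hf0 : f 0 = 1 / x (n + 2) := by simp [hf]
  have hf1 : f 1 ≤ 1 / (2 * x (n + 2)) := by
    have h1 := hpos (n + 1)
    simp only [hf]
    refine one_div_le_one_div_of_le (by linarith) ?_
    rw [show 1 + n + 2 = n + 1 + 2 by ring]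
    exact hdouble (n + 1)
  have hhalf : 1 / (2 * x (n + 2) : ℝ) = 1 / x (n + 2) / 2 := by
    rw [mul_comm, div_div]
  have hpos' : 0 < 1 / (x (n + 2) : ℝ) := one_div_pos.2 (hpos (n + 1))
  rw [htail, abs_mul, abs_pow, abs_neg, abs_one, one_pow, one_mul,
    abs_of_nonneg (by linarith)]
  constructor <;> linarith

/-- The growth rate of the denominators of the Pierce series. -/
theorem pierce_tendsto_log_ratio {u x y : ℕ → ℤ} (hx : ∀ n, 2 ≤ x (n + 1))
    (hy : ∀ n, 2 ≤ y (n + 1)) (hu : ∀ n, 1 ≤ n → 1 ≤ u n)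
    (hrec : ∀ j, 1 ≤ j → y j = y (j - 1) * (1 + u j * x j) ∧ x (j + 1) = x j * y j)
    {d : ℕ} (hd : 1 ≤ d) {v : ℕ → ℕ → ℤ}
    (hudef : ∀ n, 1 ≤ n → u n = ∑ j ∈ Finset.range d, v j n * x n ^ (d - 1 - j))
    (hv0 : ∀ n, 1 ≤ n → 1 ≤ v 0 n) {l ν K : ℝ} (hl : 1 < l)
    (hroot : l ^ 2 - (d + 2) * l + 1 = 0) (hν : ν < l)
    (hlog : ∀ᶠ n in atTop, |Real.log (v 0 n : ℝ)| ≤ K * ν ^ n)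
    (hvj : ∀ j, 1 ≤ j → j ≤ d - 1 →
      ∃ K : ℝ, ∃ N : ℕ, ∀ n, N ≤ n → |((v j n : ℤ) : ℝ)| ≤ K * ((v 0 n : ℤ) : ℝ)) :
    Tendsto (fun n => Real.log (x (n + 2)) / Real.log (x (n + 1))) atTop (𝓝 l) := by
  have hxy : ∀ n, x (n + 2) = x (n + 1) * y (n + 1) := fun n => (hrec (n + 1) (by omega)).2
  have hpos : ∀ n, (0 : ℝ) < x (n + 1) := fun n => by
    exact_mod_cast (by linarith [hx n] : 0 < x (n + 1))
  have hypos : ∀ n, (0 : ℝ) < y (n + 1) := fun n => by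
    exact_mod_cast (by linarith [hy n] : 0 < y (n + 1))
  have hgpos : ∀ n, (0 : ℝ) < 1 + u (n + 2) * x (n + 2) := fun n => by
    have h1 : (1 : ℝ) ≤ u (n + 2) := by exact_mod_cast hu (n + 2) (by omega)
    nlinarith [hpos (n + 1)]
  have hmono : StrictMono fun n => x (n + 1) := strictMono_of_mul hx hy hxy
  have htop := tendsto_log_of_strictMono hx hmono
  have hxtop : Tendsto (fun n => (x n : ℝ)) atTop atTop := by
    rw [← tendsto_add_atTop_iff_nat 1]
    refine tendsto_atTop_mono (fun n => ?_) (tendsto_natCast_atTop_atTop (R := ℝ))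
    exact_mod_cast natCast_le_of_strictMono hmono (by linarith [hx 0]) n
  have hbounds := (tendsto_add_atTop_iff_nat 2).2 (tendsto_id (α := ℕ) (x := atTop)) |>.eventually
    ((eventually_leading_term_bounds hd hxtop hv0 hvj).and (eventually_abs_le_max_one_pow hlog))
  simp only [id] at hbounds
  have hfb : ∀ᶠ n : ℕ in atTop,
      -Real.log 2 ≤ Real.log (1 + u (n + 2) * x (n + 2)) - d * Real.log (x (n + 2)) ∧
      Real.log (1 + u (n + 2) * x (n + 2)) - d * Real.log (x (n + 2)) ≤
        Real.log 2 + |K| * max 1 ν ^ (n + 2) := by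
    filter_upwards [hbounds] with n hn
    rw [← hudef (n + 2) (by omega)] at hn
    obtain ⟨⟨h1, h2⟩, h3⟩ := hn
    have hv : (1 : ℝ) ≤ v 0 (n + 2) := by exact_mod_cast hv0 (n + 2) (by omega)
    have hvp : (0 : ℝ) < v 0 (n + 2) := by linarith
    have hxd : (0 : ℝ) < (x (n + 2) : ℝ) ^ d := pow_pos (hpos (n + 1)) d
    have hm : (0 : ℝ) < v 0 (n + 2) * (x (n + 2) : ℝ) ^ d := mul_pos hvp hxd
    have hlogm : Real.log (v 0 (n + 2) * (x (n + 2) : ℝ) ^ d) =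
        Real.log (v 0 (n + 2)) + d * Real.log (x (n + 2)) := by
      rw [Real.log_mul hvp.ne' hxd.ne', Real.log_pow]
    have h4 := Real.log_le_log (by linarith) h1
    have h5 := Real.log_le_log (hgpos n) h2
    rw [Real.log_div hm.ne' two_ne_zero, hlogm] at h4
    rw [Real.log_mul two_ne_zero hm.ne', hlogm] at h5
    have h6 := Real.log_nonneg hv
    have h7 := le_abs_self (Real.log (v 0 (n + 2) : ℝ))
    constructor <;> linarith
  have hlog2 : 0 ≤ Real.log 2 := Real.log_nonneg one_le_two
  refine tendsto_ratio_of_linear_recurrence (L := fun n => Real.log (x (n + 1)))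
    (f := fun n => Real.log (1 + u (n + 2) * x (n + 2)) - d * Real.log (x (n + 2)))
    (c := d + 2) (ν := max 1 ν) (K := Real.log 2 + |K| * max 1 ν ^ 2) (B := Real.log 2)
    hl hroot (by positivity) (max_lt hl hν) hlog2 (fun n => log_pos_of_two_le hx n)
    (fun n => ?_) htop (fun n => ?_) (hfb.mono fun n h => h.1) (hfb.mono fun n h => ?_)
  · exact Real.log_le_log (hpos n) (by exact_mod_cast (hmono (Nat.lt_add_one n)).le)
  · have e1 : Real.log (x (n + 2)) = Real.log (x (n + 1)) + Real.log (y (n + 1)) := by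
      rw [hxy n]
      push_cast
      exact Real.log_mul (hpos n).ne' (hypos n).ne'
    have e2 : Real.log (x (n + 3)) = Real.log (x (n + 2)) + Real.log (y (n + 2)) := by
      rw [hxy (n + 1)]
      push_cast
      exact Real.log_mul (hpos (n + 1)).ne' (hypos (n + 1)).ne'
    have e3 : Real.log (y (n + 2)) =
        Real.log (y (n + 1)) + Real.log (1 + u (n + 2) * x (n + 2)) := by
      rw [(hrec (n + 2) (by omega)).1]
      push_cast
      exact Real.log_mul (hypos n).ne' (hgpos n).ne'
    show Real.log (x (n + 3)) = (d + 2) * Real.log (x (n + 2)) - Real.log (x (n + 1)) + _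
    linarith
  · have h1 : (1 : ℝ) ≤ max 1 ν ^ n := one_le_pow₀ (le_max_left _ _)
    have h2 : |K| * max 1 ν ^ (n + 2) = |K| * max 1 ν ^ 2 * max 1 ν ^ n := by ring
    have h3 : Real.log 2 ≤ Real.log 2 * max 1 ν ^ n := le_mul_of_one_le_right hlog2 h1
    have h4 : 0 ≤ |K| * max 1 ν ^ 2 * max 1 ν ^ n := by positivity
    rw [abs_le, add_mul]
    rw [h2] at h
    constructor <;> linarith [h.1, h.2]

end

/-- **Theorem 3.3 (Pierce case).**  If `u n = ∑_{j=0}^{d-1} v_n^{(j)} x_n^{d-1-j}` with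
`v_n^{(0)} ≥ 1`, `log v_n^{(0)} = O(ν^n)` for some `ν < λ = (d + 2 + √(d(d+4)))/2`, and
`v_n^{(j)} = O(v_n^{(0)})` for `1 ≤ j ≤ d-1`, then the modified Pierce series
`α = p/q + ∑_{j≥2} (-1)^j/x_j` has irrationality exponent exactly `λ`: the approximation set
is infinite for every `μ < λ` and finite for every `μ > λ`. -/
theorem pierce_added_irrationality_exponent
    (k : ℕ) (a : ℕ → ℤ) (ha : ∀ j, 1 ≤ j → j ≤ 2 * k → 1 ≤ a j)
    (pc qc : ℕ → ℤ)
    (hpc0 : pc 0 = 0) (hpc1 : pc 1 = 1) (hqc0 : qc 0 = 1) (hqc1 : qc 1 = 0)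
    (hpc : ∀ n, pc (n + 2) = a n * pc (n + 1) + pc n)
    (hqc : ∀ n, qc (n + 2) = a n * qc (n + 1) + qc n)
    (p q : ℤ) (hq : 1 < q) (hcop : Int.gcd p q = 1)
    (hp : p = pc (2 * k + 2)) (hqv : q = qc (2 * k + 2))
    (m : ℤ) (hm : 0 ≤ m) (hm1 : qc (2 * k + 1) = 1 → 1 ≤ m)
    (u x y : ℕ → ℤ) (hu : ∀ n, 1 ≤ n → 1 ≤ u n)
    (hx1 : x 1 = q) (hy0 : y 0 = m * q + qc (2 * k + 1) - 1)
    (hrec : ∀ j, 1 ≤ j → y j = y (j - 1) * (1 + u j * x j) ∧ x (j + 1) = x j * y j)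
    (d : ℕ) (hd : 1 ≤ d) (v : ℕ → ℕ → ℤ)
    (hudef : ∀ n, 1 ≤ n → u n = ∑ j ∈ Finset.range d, v j n * x n ^ (d - 1 - j))
    (hv0 : ∀ n, 1 ≤ n → 1 ≤ v 0 n)
    (hlog : ∃ ν : ℝ, ν < ((d : ℝ) + 2 + Real.sqrt (d * (d + 4))) / 2 ∧
      ∃ K : ℝ, ∃ N : ℕ, ∀ n, N ≤ n → |Real.log ((v 0 n : ℤ) : ℝ)| ≤ K * ν ^ n)
    (hvj : ∀ j, 1 ≤ j → j ≤ d - 1 →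
      ∃ K : ℝ, ∃ N : ℕ, ∀ n, N ≤ n → |((v j n : ℤ) : ℝ)| ≤ K * ((v 0 n : ℤ) : ℝ))
    (α : ℝ) (hα : α = (p : ℝ) / (q : ℝ) + ∑' j : ℕ, (-1 : ℝ) ^ j / (x (j + 2) : ℝ)) :
    (∀ μ : ℝ, μ < ((d : ℝ) + 2 + Real.sqrt (d * (d + 4))) / 2 → (approxSet α μ).Infinite) ∧
    (∀ μ : ℝ, ((d : ℝ) + 2 + Real.sqrt (d * (d + 4))) / 2 < μ → (approxSet α μ).Finite) := by
  have hqpos := convergent_denominator_pos ha hqc0 hqc1 hqc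
  have hqc1le : 1 ≤ qc (2 * k + 1) := by
    obtain _ | k := k
    · simp [hqv, hqc, hqc0, hqc1] at hq
    · exact (hqpos (2 * k + 1) (by omega)).1
  have hdet := convergent_determinant hpc0 hpc1 hqc0 hqc1 hpc hqc (2 * k + 1)
  rw [show 2 * k + 1 + 1 = 2 * k + 2 from rfl, ← hp, ← hqv, Odd.neg_one_pow ⟨k, rfl⟩] at hdet
  have hy0pos : 1 ≤ y 0 := by
    rcases hqc1le.eq_or_lt with h | h
    · have := hm1 h.symm
      nlinarith
    · nlinarith
  have hxy_pos : ∀ n, 2 ≤ x (n + 1) ∧ 1 ≤ y n := by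
    intro n
    induction n with
    | zero => exact ⟨by rw [hx1]; exact hq, hy0pos⟩
    | succ n ih =>
      obtain ⟨h1, h2⟩ := hrec (n + 1) (by omega)
      have h3 := hu (n + 1) (by omega)
      simp only [Nat.add_sub_cancel] at h1
      have h4 : 1 ≤ y (n + 1) := by
        have h5 : 1 ≤ 1 + u (n + 1) * x (n + 1) := by nlinarith [ih.1]
        rw [h1]
        nlinarith [ih.2]
      exact ⟨by rw [h2]; nlinarith [ih.1], h4⟩
  have hx : ∀ n, 2 ≤ x (n + 1) := fun n => (hxy_pos n).1
  have hstep : ∀ n, 3 * y n ≤ y (n + 1) := by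
    intro n
    obtain ⟨h1, -⟩ := hrec (n + 1) (by omega)
    have h3 := hu (n + 1) (by omega)
    simp only [Nat.add_sub_cancel] at h1
    have h4 : 3 ≤ 1 + u (n + 1) * x (n + 1) := by nlinarith [hx n]
    rw [h1]
    nlinarith [(hxy_pos n).2]
  have hy : ∀ n, 2 ≤ y (n + 1) := fun n => by linarith [hstep n, (hxy_pos n).2]
  have hymono : StrictMono fun n => y (n + 1) :=
    strictMono_nat_of_lt_succ fun n => by linarith [hstep (n + 1), hy n]
  have hxy : ∀ n, x (n + 2) = x (n + 1) * y (n + 1) := fun n => (hrec (n + 1) (by omega)).2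
  have hdvd : x 1 ∣ p * (y 0 + 1) + 1 :=
    ⟨p * m + pc (2 * k + 1), by rw [hx1, hy0]; linear_combination hdet⟩
  rw [← hx1] at hα
  have herr := pierce_error_bounds hx hy hxy hα
  have hne : ∀ n, 0 < |α - pierceNumerator p y n / x (n + 1)| := fun n => by
    have h1 : (0 : ℝ) < x (n + 2) := by exact_mod_cast (by linarith [hx (n + 1)] : 0 < x (n + 2))
    exact lt_of_lt_of_le (by positivity) (herr n).1
  set l : ℝ := ((d : ℝ) + 2 + Real.sqrt (d * (d + 4))) / 2 with hl
  have hd1 : (1 : ℝ) ≤ d := by exact_mod_cast hd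
  have hsq := Real.sq_sqrt (show (0 : ℝ) ≤ d * (d + 4) by positivity)
  have hsq0 := Real.sqrt_nonneg ((d : ℝ) * (d + 4))
  have hl1 : 1 < l := by linarith
  have hroot : l ^ 2 - (d + 2) * l + 1 = 0 := by
    rw [hl]
    linear_combination hsq / 4
  have hl2 : l ≤ (l - 1) ^ 2 := by nlinarith
  obtain ⟨ν, hν, K, N, hKN⟩ := hlog
  have hlim := pierce_tendsto_log_ratio hx hy hu hrec hd hudef hv0 hl1 hroot hν
    (Filter.eventually_atTop.2 ⟨N, hKN⟩) hvj
  exact ⟨fun μ hμ => approxSet_infinite hx (strictMono_of_mul hx hy hxy) hne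
      (fun n => (herr n).2) hlim hμ,
    fun μ hμ => approxSet_finite hl1 hl2 hx hy hymono hxy (isCoprime_pierceNumerator hrec hdvd)
      (fun n => (herr n).2) (fun n => (herr n).1) hlim hμ⟩
end

section
/- For every real number ν ≥ (3 + √5)/2 there exist infinitely many distinct real numbers α of the form α = p/q + Σ_{j=2}^∞ 1/x_j, where p/q ∈ ℚ is in lowest terms with q ≥ 1, m ≥ 0 is an integer, and (x_n) is defined by x_1 = q, y_0 = m·q + q_{2k-1} + 1, y_j = y_{j-1}(1 + u_j·x_j), x_{j+1} = x_j·y_j for some sequence (u_n)_{n≥1} of positive integers, such that the irrationality exponent of α equals ν. -/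
/-- `α` has irrationality exponent exactly `ν`: the approximation set is infinite for every
`μ < ν` and finite for every `μ > ν`. -/
def HasIrrationalityExponent (α ν : ℝ) : Prop :=
  (∀ μ : ℝ, μ < ν → (approxSet α μ).Infinite) ∧
  (∀ μ : ℝ, ν < μ → (approxSet α μ).Finite)

/-- `α` is a modified Engel series: `α = p/q + ∑_{j≥2} 1/x_j`, where `p/q = [a_0;a_1,…,a_{2k}]`
is in lowest terms with `q ≥ 1` (convergents `pc, qc`, with `pc (n+2), qc (n+2)` the paper's
`p_n, q_n`), `m ≥ 0`, `(u_n)` is a sequence of positive integers, and `x 1 = q`,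
`y 0 = m*q + q_{2k-1} + 1`, `y j = y (j-1)*(1 + u j * x j)`, `x (j+1) = x j * y j`. -/
def IsModifiedEngelSeries (α : ℝ) : Prop :=
  ∃ (k : ℕ) (a : ℕ → ℤ) (pc qc : ℕ → ℤ) (p q m : ℤ) (u x y : ℕ → ℤ),
    (∀ j, 1 ≤ j → j ≤ 2 * k → 1 ≤ a j) ∧
    pc 0 = 0 ∧ pc 1 = 1 ∧ qc 0 = 1 ∧ qc 1 = 0 ∧
    (∀ n, pc (n + 2) = a n * pc (n + 1) + pc n) ∧
    (∀ n, qc (n + 2) = a n * qc (n + 1) + qc n) ∧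
    1 ≤ q ∧ Int.gcd p q = 1 ∧ p = pc (2 * k + 2) ∧ q = qc (2 * k + 2) ∧
    0 ≤ m ∧ (∀ n, 1 ≤ n → 1 ≤ u n) ∧
    x 1 = q ∧ y 0 = m * q + qc (2 * k + 1) + 1 ∧
    (∀ j, 1 ≤ j → y j = y (j - 1) * (1 + u j * x j) ∧ x (j + 1) = x j * y j) ∧
    α = (p : ℝ) / (q : ℝ) + ∑' j : ℕ, (1 : ℝ) / (x (j + 2) : ℝ)

open Filter

/-- The pairs `(x_{n+1}, y_n)` of the Engel recursion with `x_1 = y_0 = 1`, where the multiplier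
`u_{n+1}` is the least positive integer for which `x_{n+2} ≥ x_{n+1} ^ ν` is guaranteed. -/
noncomputable def engelState (ν : ℝ) : ℕ → ℕ × ℕ
  | 0 => (1, 1)
  | n + 1 =>
    let s := engelState ν n
    let y := s.2 * (1 + ⌈(s.1 : ℝ) ^ (ν - 2) / (s.2 : ℝ)⌉₊ * s.1)
    (s.1 * y, y)

/-- The denominators `x_{n+1}`. -/
noncomputable def engelX (ν : ℝ) (n : ℕ) : ℕ := (engelState ν n).1

/-- The ratios `y_n`. -/
noncomputable def engelY (ν : ℝ) (n : ℕ) : ℕ := (engelState ν n).2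

/-- The multipliers `u_{n+1}`. -/
noncomputable def engelU (ν : ℝ) (n : ℕ) : ℕ := ⌈(engelX ν n : ℝ) ^ (ν - 2) / (engelY ν n : ℝ)⌉₊

/-- The numerators of the partial sums of the Engel series with integer part `c`. -/
noncomputable def engelNum (ν : ℝ) (c : ℤ) : ℕ → ℤ
  | 0 => c
  | n + 1 => engelNum ν c n * engelY ν (n + 1) + 1

/-- The linear recurrence satisfied by the convergents of `[c; c, c, …]`. -/
def constContinuant (c s t : ℤ) : ℕ → ℤ
  | 0 => s
  | 1 => t
  | n + 2 => c * constContinuant c s t (n + 1) + constContinuant c s t n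

section EngelSequence

variable (ν : ℝ)

@[simp] lemma engelX_zero : engelX ν 0 = 1 := rfl

@[simp] lemma engelY_zero : engelY ν 0 = 1 := rfl

lemma engelY_succ (n : ℕ) :
    engelY ν (n + 1) = engelY ν n * (1 + engelU ν n * engelX ν n) := rfl

lemma engelX_succ (n : ℕ) : engelX ν (n + 1) = engelX ν n * engelY ν (n + 1) := rfl

lemma engelX_engelY_pos (n : ℕ) : 0 < engelX ν n ∧ 0 < engelY ν n := by
  induction n with
  | zero => simp
  | succ n ih =>
    have hy : 0 < engelY ν (n + 1) := by
      rw [engelY_succ]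
      exact Nat.mul_pos ih.2 (by omega)
    exact ⟨by rw [engelX_succ]; exact Nat.mul_pos ih.1 hy, hy⟩

lemma engelX_pos (n : ℕ) : 0 < engelX ν n := (engelX_engelY_pos ν n).1

lemma engelY_pos (n : ℕ) : 0 < engelY ν n := (engelX_engelY_pos ν n).2

lemma one_le_engelX_cast (n : ℕ) : (1 : ℝ) ≤ engelX ν n := by
  exact_mod_cast engelX_pos ν n

lemma one_le_engelY_cast (n : ℕ) : (1 : ℝ) ≤ engelY ν n := by
  exact_mod_cast engelY_pos ν n

lemma engelU_pos (n : ℕ) : 0 < engelU ν n := by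
  have hx := one_le_engelX_cast ν n
  have hy := one_le_engelY_cast ν n
  exact Nat.ceil_pos.2 (by positivity)

lemma two_mul_engelY_le (n : ℕ) : 2 * engelY ν n ≤ engelY ν (n + 1) := by
  rw [engelY_succ, mul_comm]
  exact Nat.mul_le_mul_left _ (by have := Nat.mul_pos (engelU_pos ν n) (engelX_pos ν n); omega)

lemma two_mul_engelX_le (n : ℕ) : 2 * engelX ν n ≤ engelX ν (n + 1) := by
  rw [engelX_succ, mul_comm]
  exact Nat.mul_le_mul_left _ (by have := two_mul_engelY_le ν n; have := engelY_pos ν n; omega)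

lemma engelY_strictMono : StrictMono (engelY ν) :=
  strictMono_nat_of_lt_succ fun n => by
    have := two_mul_engelY_le ν n; have := engelY_pos ν n; omega

lemma engelX_strictMono : StrictMono (engelX ν) :=
  strictMono_nat_of_lt_succ fun n => by
    have := two_mul_engelX_le ν n; have := engelX_pos ν n; omega

lemma engelX_rpow_le (n : ℕ) : (engelX ν n : ℝ) ^ ν ≤ engelX ν (n + 1) := by
  have hx := one_le_engelX_cast ν n
  have hy := one_le_engelY_cast ν n
  have hu : (engelX ν n : ℝ) ^ (ν - 2) / engelY ν n ≤ engelU ν n := Nat.le_ceil _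
  rw [div_le_iff₀ (by positivity)] at hu
  have e : (engelX ν n : ℝ) ^ ν = (engelX ν n : ℝ) ^ (ν - 2) * (engelX ν n : ℝ) ^ 2 := by
    rw [← Real.rpow_add_natCast (by positivity)]; norm_num
  rw [engelX_succ, engelY_succ, e]
  push_cast
  calc _ ≤ (engelU ν n * engelY ν n : ℝ) * (engelX ν n : ℝ) ^ 2 := by gcongr
    _ ≤ _ := by nlinarith [mul_pos (by positivity : (0 : ℝ) < engelX ν n)
                  (by positivity : (0 : ℝ) < engelY ν n)]

variable {ν}

lemma engelX_succ_le_of_sq_mul_le {n : ℕ}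
    (h : (engelX ν n : ℝ) ^ 2 * engelY ν n ≤ 3 * (engelX ν n : ℝ) ^ ν) :
    (engelX ν (n + 1) : ℝ) ≤ 9 * (engelX ν n : ℝ) ^ ν := by
  have hx := one_le_engelX_cast ν n
  have hy := one_le_engelY_cast ν n
  have hu : (engelU ν n : ℝ) ≤ (engelX ν n : ℝ) ^ (ν - 2) / engelY ν n + 1 :=
    (Nat.ceil_lt_add_one (by positivity)).le
  have e : (engelX ν n : ℝ) ^ ν = (engelX ν n : ℝ) ^ (ν - 2) * (engelX ν n : ℝ) ^ 2 := by
    rw [← Real.rpow_add_natCast (by positivity)]; norm_num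
  have hpos : 0 < (engelX ν n : ℝ) ^ ν := by positivity
  calc (engelX ν (n + 1) : ℝ)
      = engelX ν n * (engelY ν n * (1 + engelU ν n * engelX ν n)) := by
        rw [engelX_succ, engelY_succ]; push_cast; ring
    _ ≤ engelX ν n * (engelY ν n *
          (engelX ν n + ((engelX ν n : ℝ) ^ (ν - 2) / engelY ν n + 1) * engelX ν n)) := by gcongr
    _ = 2 * ((engelX ν n : ℝ) ^ 2 * engelY ν n) + (engelX ν n : ℝ) ^ ν := by
        rw [e]; field_simp; ring
    _ ≤ _ := by linarith

lemma five_halves_le_of_golden_le (hν : (3 + √5) / 2 ≤ ν) : 5 / 2 ≤ ν := by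
  have : (2 : ℝ) ≤ √5 := Real.le_sqrt_of_sq_le (by norm_num)
  linarith

lemma mul_three_sub_le_one (hν : (3 + √5) / 2 ≤ ν) : ν * (3 - ν) ≤ 1 := by
  have h5 : √5 ^ 2 = 5 := Real.sq_sqrt (by norm_num)
  nlinarith [Real.sqrt_nonneg 5]

lemma engelX_sq_mul_le (hν : (3 + √5) / 2 ≤ ν) {n : ℕ}
    (h : (engelX ν (n + 1) : ℝ) ≤ 9 * (engelX ν n : ℝ) ^ ν) :
    (engelX ν (n + 1) : ℝ) ^ 2 * engelY ν (n + 1) ≤ 3 * (engelX ν (n + 1) : ℝ) ^ ν := by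
  have hx := one_le_engelX_cast ν n
  have hx' := one_le_engelX_cast ν (n + 1)
  have hν' := five_halves_le_of_golden_le hν
  have key : (engelX ν (n + 1) : ℝ) ^ (3 - ν) ≤ 3 * engelX ν n := by
    rcases le_total 3 ν with h3 | h3
    · have := Real.rpow_le_one_of_one_le_of_nonpos hx' (by linarith : 3 - ν ≤ 0)
      linarith
    · calc (engelX ν (n + 1) : ℝ) ^ (3 - ν) ≤ (9 * (engelX ν n : ℝ) ^ ν) ^ (3 - ν) := by
            gcongr
        _ = 9 ^ (3 - ν) * (engelX ν n : ℝ) ^ (ν * (3 - ν)) := by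
            rw [Real.mul_rpow (by norm_num) (by positivity), Real.rpow_mul (by positivity)]
        _ ≤ 9 ^ (1 / 2 : ℝ) * (engelX ν n : ℝ) ^ (1 : ℝ) := by
            gcongr
            · norm_num
            · linarith
            · exact mul_three_sub_le_one hν
        _ = 3 * engelX ν n := by
            rw [Real.rpow_one, ← Real.sqrt_eq_rpow, show (9 : ℝ) = 3 ^ 2 by norm_num,
              Real.sqrt_sq (by norm_num)]
  have e : (engelX ν (n + 1) : ℝ) ^ 3
      = (engelX ν (n + 1) : ℝ) ^ ν * (engelX ν (n + 1) : ℝ) ^ (3 - ν) := by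
    rw [← Real.rpow_add (by positivity), ← Real.rpow_natCast]; norm_num
  refine le_of_mul_le_mul_left ?_ (by positivity : (0 : ℝ) < engelX ν n)
  calc (engelX ν n : ℝ) * ((engelX ν (n + 1) : ℝ) ^ 2 * engelY ν (n + 1))
      = (engelX ν (n + 1) : ℝ) ^ 3 := by rw [engelX_succ]; push_cast; ring
    _ ≤ (engelX ν (n + 1) : ℝ) ^ ν * (3 * engelX ν n) := by rw [e]; gcongr
    _ = _ := by ring

lemma engelX_succ_le (hν : (3 + √5) / 2 ≤ ν) (n : ℕ) :
    (engelX ν (n + 1) : ℝ) ≤ 9 * (engelX ν n : ℝ) ^ ν := by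
  induction n with
  | zero => exact engelX_succ_le_of_sq_mul_le (by simp)
  | succ n ih => exact engelX_succ_le_of_sq_mul_le (engelX_sq_mul_le hν ih)

lemma engelX_succ_le_engelY_rpow (hν : (3 + √5) / 2 ≤ ν) (n : ℕ) :
    (engelX ν (n + 1) : ℝ) ≤ 9 * (engelY ν (n + 1) : ℝ) ^ (ν - 1) := by
  have hx := one_le_engelX_cast ν n
  have hν' := five_halves_le_of_golden_le hν
  have hY : (engelX ν n : ℝ) ^ (ν - 1) ≤ engelY ν (n + 1) := by
    rw [Real.rpow_sub_one (by positivity), div_le_iff₀ (by positivity)]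
    calc _ ≤ (engelX ν (n + 1) : ℝ) := engelX_rpow_le ν n
      _ = _ := by rw [engelX_succ]; push_cast; ring
  calc (engelX ν (n + 1) : ℝ) ≤ 9 * (engelX ν n : ℝ) ^ ν := engelX_succ_le hν n
    _ ≤ 9 * (engelX ν n : ℝ) ^ ((ν - 1) * (ν - 1)) := by
        gcongr 9 * ?_
        refine Real.rpow_le_rpow_of_exponent_le hx ?_
        linarith [mul_three_sub_le_one hν]
    _ = 9 * ((engelX ν n : ℝ) ^ (ν - 1)) ^ (ν - 1) := by rw [Real.rpow_mul (by positivity)]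
    _ ≤ _ := by gcongr; linarith

variable (ν)

lemma engelX_dvd_engelY_pow (n : ℕ) : engelX ν n ∣ engelY ν n ^ n := by
  induction n with
  | zero => simp
  | succ n ih =>
    rw [engelX_succ, pow_succ]
    exact mul_dvd_mul_right (ih.trans (pow_dvd_pow_of_dvd ⟨_, engelY_succ ν n⟩ n)) _

lemma isCoprime_engelNum (c : ℤ) (n : ℕ) : IsCoprime (engelNum ν c n) (engelX ν n : ℤ) := by
  cases n with
  | zero => simp [isCoprime_one_right]
  | succ n =>
    have h : IsCoprime (engelNum ν c (n + 1)) (engelY ν (n + 1) : ℤ) :=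
      ⟨1, -engelNum ν c n, by simp only [engelNum]; ring⟩
    exact (h.pow_right (n := n + 1)).of_isCoprime_of_dvd_right
      (by exact_mod_cast engelX_dvd_engelY_pow ν (n + 1))

lemma one_div_engelX_add_le (n i : ℕ) :
    1 / (engelX ν (n + i) : ℝ) ≤ 1 / (engelX ν n : ℝ) * (1 / 2) ^ i := by
  induction i with
  | zero => simp
  | succ i ih =>
    have hx := one_le_engelX_cast ν (n + i)
    have h2 : 2 * (engelX ν (n + i) : ℝ) ≤ engelX ν (n + i + 1) := by
      exact_mod_cast two_mul_engelX_le ν (n + i)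
    calc 1 / (engelX ν (n + (i + 1)) : ℝ) ≤ 1 / (2 * (engelX ν (n + i) : ℝ)) :=
          one_div_le_one_div_of_le (by positivity) h2
      _ = 1 / (engelX ν (n + i) : ℝ) * (1 / 2) := by field_simp
      _ ≤ 1 / (engelX ν n : ℝ) * (1 / 2) ^ i * (1 / 2) := by gcongr
      _ = _ := by ring

lemma summable_one_div_engelX (n : ℕ) : Summable fun i => 1 / (engelX ν (n + i) : ℝ) :=
  Summable.of_nonneg_of_le (fun _ => by positivity) (one_div_engelX_add_le ν n)
    (summable_geometric_two.mul_left _)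

/-- The sum of the Engel series with integer part `c`. -/
noncomputable def engelSum (c : ℤ) : ℝ := c + ∑' i : ℕ, 1 / (engelX ν (1 + i) : ℝ)

lemma engelSum_eq (c : ℤ) (n : ℕ) :
    engelSum ν c = engelNum ν c n / engelX ν n + ∑' i : ℕ, 1 / (engelX ν (n + 1 + i) : ℝ) := by
  induction n with
  | zero => simp [engelSum, engelNum]
  | succ n ih =>
    rw [ih, (summable_one_div_engelX ν (n + 1)).tsum_eq_zero_add, ← add_assoc]
    congr 1
    · have hx := one_le_engelX_cast ν n
      have hy := one_le_engelY_cast ν (n + 1)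
      simp only [engelNum, add_zero, engelX_succ]
      push_cast
      field_simp
    · exact tsum_congr fun i => by congr 3; omega

lemma engelSum_sub_le (c : ℤ) (n : ℕ) :
    engelSum ν c - engelNum ν c n / engelX ν n ≤ 2 / engelX ν (n + 1) := by
  rw [engelSum_eq ν c n, add_sub_cancel_left]
  calc _ ≤ ∑' i : ℕ, 1 / (engelX ν (n + 1) : ℝ) * (1 / 2) ^ i :=
        (summable_one_div_engelX ν (n + 1)).tsum_le_tsum (one_div_engelX_add_le ν (n + 1))
          (summable_geometric_two.mul_left _)
    _ = _ := by rw [tsum_mul_left, tsum_geometric_two]; ring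

lemma le_engelSum_sub (c : ℤ) (n : ℕ) :
    1 / (engelX ν (n + 1) : ℝ) ≤ engelSum ν c - engelNum ν c n / engelX ν n := by
  rw [engelSum_eq ν c n, add_sub_cancel_left]
  exact (summable_one_div_engelX ν (n + 1)).le_tsum 0 fun _ _ => by positivity

end EngelSequence

lemma approxSet_finite_of_denominators_bounded {α μ : ℝ} (hμ : 0 ≤ μ) (B : ℤ)
    (h : ∀ P Q : ℤ, (P, Q) ∈ approxSet α μ → Q ≤ B) : (approxSet α μ).Finite := by
  have hfin : (⋃ Q ∈ Set.Icc 1 B,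
      (Set.Icc ⌊(α - 1) * Q⌋ ⌈(α + 1) * Q⌉ ×ˢ ({Q} : Set ℤ) : Set (ℤ × ℤ))).Finite :=
    (Set.finite_Icc 1 B).biUnion fun Q _ => (Set.finite_Icc _ _).prod (Set.finite_singleton Q)
  refine hfin.subset ?_
  rintro ⟨P, Q⟩ hPQ
  have hB := h P Q hPQ
  obtain ⟨hQ, -, hlt⟩ := hPQ
  dsimp only at hQ hlt
  have hQ' : (1 : ℝ) ≤ Q := by exact_mod_cast hQ
  have h1 : 1 / (Q : ℝ) ^ μ ≤ 1 := by
    rw [div_le_one (by positivity)]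
    exact Real.one_le_rpow hQ' hμ
  obtain ⟨hl, hr⟩ := abs_lt.1 (hlt.trans_le h1)
  have hPQ' : (P : ℝ) / Q * Q = P := div_mul_cancel₀ _ (by positivity)
  simp only [Set.mem_iUnion, Set.mem_prod, Set.mem_singleton_iff, Set.mem_Icc]
  refine ⟨Q, ⟨hQ, hB⟩, ⟨?_, ?_⟩, rfl⟩
  · have : (⌊(α - 1) * Q⌋ : ℝ) ≤ P := (Int.floor_le _).trans (by nlinarith)
    exact_mod_cast this
  · have : (P : ℝ) ≤ ⌈(α + 1) * Q⌉ := le_trans (by nlinarith) (Int.le_ceil _)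
    exact_mod_cast this

lemma approxSet_engelSum_infinite {ν μ : ℝ} (c : ℤ) (hμ : μ < ν) :
    (approxSet (engelSum ν c) μ).Infinite := by
  have hX : Tendsto (fun n => (engelX ν n : ℝ)) atTop atTop :=
    tendsto_natCast_atTop_atTop.comp (engelX_strictMono ν).tendsto_atTop
  obtain ⟨N, hN⟩ := eventually_atTop.1
    (((tendsto_rpow_atTop (sub_pos.2 hμ)).comp hX).eventually_gt_atTop 2)
  have hinj : Function.Injective fun i =>
      ((engelNum ν c (N + i), (engelX ν (N + i) : ℤ)) : ℤ × ℤ) := by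
    intro i j hij
    have := (engelX_strictMono ν).injective (Int.ofNat_injective (Prod.ext_iff.1 hij).2)
    omega
  refine Set.infinite_of_injective_forall_mem hinj fun i => ?_
  have hx := one_le_engelX_cast ν (N + i)
  have hx' := one_le_engelX_cast ν (N + i + 1)
  have hlow := le_engelSum_sub ν c (N + i)
  have hupp := engelSum_sub_le ν c (N + i)
  have hpos : 0 < engelSum ν c - engelNum ν c (N + i) / engelX ν (N + i) :=
    lt_of_lt_of_le (by positivity) hlow
  have hgt : 2 < (engelX ν (N + i) : ℝ) ^ (ν - μ) := hN (N + i) (by omega)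
  refine ⟨?_, ?_, ?_⟩
  · exact Int.natCast_pos.2 (engelX_pos ν (N + i))
  · simpa using hpos.ne'
  · simp only [Int.cast_natCast]
    rw [abs_of_pos hpos]
    refine hupp.trans_lt ?_
    rw [div_lt_div_iff₀ (by positivity) (by positivity), one_mul]
    calc 2 * (engelX ν (N + i) : ℝ) ^ μ
        < (engelX ν (N + i) : ℝ) ^ (ν - μ) * (engelX ν (N + i) : ℝ) ^ μ := by gcongr
      _ = (engelX ν (N + i) : ℝ) ^ ν := by rw [← Real.rpow_add (by positivity)]; norm_num
      _ ≤ _ := engelX_rpow_le ν (N + i)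

lemma le_of_div_eq_engelNum_div {ν : ℝ} {c P Q : ℤ} {n : ℕ} (hQ : 1 ≤ Q)
    (h : (P : ℝ) / Q = engelNum ν c n / engelX ν n) : (engelX ν n : ℤ) ≤ Q := by
  have hx := one_le_engelX_cast ν n
  have hQ' : (1 : ℝ) ≤ Q := by exact_mod_cast hQ
  rw [div_eq_div_iff (by positivity) (by positivity)] at h
  have h' : P * (engelX ν n : ℤ) = engelNum ν c n * Q := by exact_mod_cast h
  exact Int.le_of_dvd (by omega)
    ((isCoprime_engelNum ν c n).symm.dvd_of_dvd_mul_left (Dvd.intro_left P h'))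

lemma one_div_le_abs_engelSum_sub {ν : ℝ} {c P Q : ℤ} {n : ℕ} (hQ : 1 ≤ Q)
    (hY : 4 * Q < engelY ν (n + 1)) (h : (P : ℝ) / Q ≠ engelNum ν c n / engelX ν n) :
    1 / (2 * Q * engelX ν n : ℝ) ≤ |engelSum ν c - P / Q| := by
  have hx := one_le_engelX_cast ν n
  have hx' := one_le_engelX_cast ν (n + 1)
  have hy := one_le_engelY_cast ν (n + 1)
  have hQ' : (1 : ℝ) ≤ Q := by exact_mod_cast hQ
  have hY' : 4 * (Q : ℝ) < engelY ν (n + 1) := by exact_mod_cast hY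
  have hgap : 1 / (Q * engelX ν n : ℝ) ≤ |(P : ℝ) / Q - engelNum ν c n / engelX ν n| := by
    rw [div_sub_div _ _ (by positivity) (by positivity), abs_div,
      abs_of_pos (by positivity : (0 : ℝ) < Q * engelX ν n)]
    gcongr
    have hne : P * (engelX ν n : ℤ) - Q * engelNum ν c n ≠ 0 := by
      intro h0
      apply h
      rw [div_eq_div_iff (by positivity) (by positivity)]
      have : P * (engelX ν n : ℤ) = engelNum ν c n * Q := by linarith
      exact_mod_cast this
    exact_mod_cast Int.one_le_abs hne
  have htail : |engelSum ν c - engelNum ν c n / engelX ν n| ≤ 1 / (2 * Q * engelX ν n : ℝ) := by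
    rw [abs_of_nonneg (le_trans (by positivity) (le_engelSum_sub ν c n))]
    refine (engelSum_sub_le ν c n).trans ?_
    rw [div_le_div_iff₀ (by positivity) (by positivity), engelX_succ]
    push_cast
    nlinarith
  have hsplit : 1 / (Q * engelX ν n : ℝ) = 2 * (1 / (2 * Q * engelX ν n : ℝ)) := by field_simp
  have htri := abs_sub_le ((P : ℝ) / Q) (engelSum ν c) (engelNum ν c n / engelX ν n)
  rw [abs_sub_comm ((P : ℝ) / Q) (engelSum ν c)] at htri
  linarith

lemma exists_engelY_le_lt {ν : ℝ} {Q : ℤ} (hQ : 1 ≤ Q) (h : engelY ν 1 ≤ 4 * Q) :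
    ∃ n, engelY ν (n + 1) ≤ 4 * Q ∧ 4 * Q < engelY ν (n + 2) := by
  lift Q to ℕ using by omega
  have hex : ∃ n, 4 * Q < engelY ν (n + 2) :=
    ⟨4 * Q, by have := (engelY_strictMono ν).le_apply (x := 4 * Q + 2); omega⟩
  classical
  refine ⟨Nat.find hex, ?_, by exact_mod_cast Nat.find_spec hex⟩
  rcases hn : Nat.find hex with _ | n
  · exact h
  · have := Nat.find_min hex (m := n) (by omega)
    exact_mod_cast not_lt.1 this

lemma approxSet_engelSum_finite {ν μ : ℝ} (hν : (3 + √5) / 2 ≤ ν) (c : ℤ) (hμ : ν < μ) :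
    (approxSet (engelSum ν c) μ).Finite := by
  have hν' := five_halves_le_of_golden_le hν
  obtain ⟨B, hB⟩ := eventually_atTop.1 (((tendsto_rpow_atTop (sub_pos.2 hμ)).comp
    (tendsto_intCast_atTop_atTop (R := ℝ))).eventually_ge_atTop (18 * 4 ^ (ν - 1)))
  refine approxSet_finite_of_denominators_bounded (by linarith) (max B (engelY ν 1)) ?_
  rintro P Q ⟨hQ, -, hlt⟩
  dsimp only at hQ hlt
  by_contra! hbig
  obtain ⟨hQB, hQY⟩ := max_lt_iff.1 hbig
  have hQ' : (1 : ℝ) ≤ Q := by exact_mod_cast hQ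
  have hlarge : 18 * 4 ^ (ν - 1) ≤ (Q : ℝ) ^ (μ - ν) := hB Q hQB.le
  obtain ⟨n, hle, hgt⟩ := exists_engelY_le_lt (ν := ν) hQ (by omega)
  have hx := one_le_engelX_cast ν (n + 1)
  have hx' := one_le_engelX_cast ν (n + 2)
  have hsplit : (Q : ℝ) ^ μ = (Q : ℝ) ^ (μ - ν) * (Q : ℝ) ^ ν := by
    rw [← Real.rpow_add (by positivity)]; norm_num
  refine absurd hlt (not_lt.2 ?_)
  by_cases heq : (P : ℝ) / Q = engelNum ν c (n + 1) / engelX ν (n + 1)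
  · have hXQ : (engelX ν (n + 1) : ℝ) ≤ Q := by
      exact_mod_cast le_of_div_eq_engelNum_div hQ heq
    have h4 : (1 : ℝ) ≤ 4 ^ (ν - 1) := Real.one_le_rpow (by norm_num) (by linarith)
    rw [heq]
    refine le_trans ?_ ((le_engelSum_sub ν c (n + 1)).trans (le_abs_self _))
    refine one_div_le_one_div_of_le (by positivity) ?_
    calc (engelX ν (n + 2) : ℝ) ≤ 9 * (engelX ν (n + 1) : ℝ) ^ ν := engelX_succ_le hν (n + 1)
      _ ≤ (Q : ℝ) ^ (μ - ν) * (Q : ℝ) ^ ν := by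
          gcongr
          · linarith
      _ = _ := hsplit.symm
  · refine le_trans ?_ (one_div_le_abs_engelSum_sub hQ hgt heq)
    refine one_div_le_one_div_of_le (by positivity) ?_
    have hY : (engelY ν (n + 1) : ℝ) ≤ 4 * Q := by exact_mod_cast hle
    calc (2 * Q * engelX ν (n + 1) : ℝ) ≤ 2 * Q * (9 * (engelY ν (n + 1) : ℝ) ^ (ν - 1)) := by
          gcongr; exact engelX_succ_le_engelY_rpow hν n
      _ ≤ 2 * Q * (9 * (4 * Q : ℝ) ^ (ν - 1)) := by
          gcongr; linarith
      _ = 18 * 4 ^ (ν - 1) * (Q : ℝ) ^ ν := by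
          rw [Real.mul_rpow (by norm_num) (by positivity), Real.rpow_sub_one (by positivity : (Q : ℝ) ≠ 0)]
          field_simp
          norm_num
      _ ≤ (Q : ℝ) ^ (μ - ν) * (Q : ℝ) ^ ν := by gcongr
      _ = _ := hsplit.symm

lemma isModifiedEngelSeries_engelSum (ν : ℝ) (c : ℤ) :
    IsModifiedEngelSeries (engelSum ν c) := by
  refine ⟨0, fun _ => c, constContinuant c 0 1, constContinuant c 1 0, c, 1, 0,
    fun j => engelU ν (j - 1), fun j => engelX ν (j - 1), fun j => engelY ν j,
    fun j h1 h2 => by omega, rfl, rfl, rfl, rfl, fun _ => rfl, fun _ => rfl, le_rfl, by simp,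
    by simp [constContinuant], by simp [constContinuant], le_rfl,
    fun n _ => Int.natCast_pos.2 (engelU_pos ν _), by simp, by simp [constContinuant],
    fun j hj => ?_, ?_⟩
  · obtain ⟨n, rfl⟩ := Nat.exists_eq_add_of_le' hj
    simp only [Nat.add_sub_cancel, engelX_succ]
    rw [engelY_succ]
    push_cast
    exact ⟨rfl, rfl⟩
  · simp [engelSum, add_comm 1]

/-- **Theorem 3.4 (Engel case).**  For every `ν ≥ (3 + √5)/2` there are infinitely many
distinct real numbers `α` given by a modified Engel series whose irrationality exponent
equals `ν`. -/
theorem infinitely_many_with_given_irrationality_exponent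
    (ν : ℝ) (hν : (3 + Real.sqrt 5) / 2 ≤ ν) :
    {α : ℝ | IsModifiedEngelSeries α ∧ HasIrrationalityExponent α ν}.Infinite := by
  have hinj : Function.Injective (engelSum ν) := fun c d h => by
    simpa [engelSum] using h
  exact Set.infinite_of_injective_forall_mem hinj fun c =>
    ⟨isModifiedEngelSeries_engelSum ν c,
      fun _ hμ => approxSet_engelSum_infinite c hμ,
      fun _ hμ => approxSet_engelSum_finite hν c hμ⟩
end

section
/- Let d ≥ 1 be an integer and set λ = (d + 2 + √(d(d+4)))/2, so that λ + λ^{−1} = d + 2. Suppose (Λ_n)_{n≥1} and (Δ_n)_{n≥2} are real sequences satisfying Λ_{n+1} − (d+2)·Λ_n + Λ_{n−1} = Δ_n for all n ≥ 2, and that Δ_n = O(ν^n) as n → ∞ for some real ν with 0 < ν < λ. Then the sequence Λ_n/λ^n converges to a finite limit as n → ∞. -/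
open Filter Topology

/-- If `w (n + 1) = w n / l + e n` with `l > 1` and `|e n| ≤ A * m ^ (n + 1)` for some `m ≥ 1`,
then `w n = O(m ^ n)`. -/
lemma exists_abs_le_mul_pow_of_contracting {w e : ℕ → ℝ} {l m A : ℝ} (hl : 1 < l) (hm : 1 ≤ m)
    (hA : 0 ≤ A) (hw : ∀ n, w (n + 1) = w n / l + e n) (he : ∀ n, |e n| ≤ A * m ^ (n + 1)) :
    ∃ C, ∀ n, |w n| ≤ C * m ^ n := by
  have hl0 : 0 < l := by linarith
  have hl1 : 0 < l - 1 := by linarith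
  refine ⟨|w 0| + A * l / (l - 1), fun n => ?_⟩
  set C := |w 0| + A * l / (l - 1) with hC
  have hC0 : 0 ≤ C := by positivity
  induction n with
  | zero =>
    have : 0 ≤ A * l / (l - 1) := by positivity
    simp [hC, this]
  | succ n ih =>
    have hAC : A ≤ C * (1 - 1 / l) := by
      have h1 : A = A * l / (l - 1) * (1 - 1 / l) := by field_simp
      have h2 : 0 ≤ 1 - 1 / l := by
        rw [sub_nonneg, div_le_one hl0]; exact hl.le
      calc A = A * l / (l - 1) * (1 - 1 / l) := h1
        _ ≤ C * (1 - 1 / l) := by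
          apply mul_le_mul_of_nonneg_right _ h2
          rw [hC]; linarith [abs_nonneg (w 0)]
    calc |w (n + 1)| ≤ |w n| / l + |e n| := by
          rw [hw, ← abs_of_pos hl0, ← abs_div, abs_of_pos hl0]; exact abs_add_le _ _
      _ ≤ C * m ^ (n + 1) / l + C * (1 - 1 / l) * m ^ (n + 1) := by
          have hmm : m ^ n ≤ m ^ (n + 1) := pow_le_pow_right₀ hm n.le_succ
          have h3 : |w n| ≤ C * m ^ (n + 1) := ih.trans (mul_le_mul_of_nonneg_left hmm hC0)
          have h4 : |e n| ≤ C * (1 - 1 / l) * m ^ (n + 1) :=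
            (he n).trans (mul_le_mul_of_nonneg_right hAC (by positivity))
          gcongr
      _ = C * m ^ (n + 1) := by field_simp; ring

/-- If `|x (n + 1) - l * x n| ≤ C * m ^ n` with `0 ≤ m < l`, then `x n / l ^ n` converges. -/
lemma exists_tendsto_div_pow_of_abs_sub_le {x : ℕ → ℝ} {l m C : ℝ} (hm : 0 ≤ m) (hml : m < l)
    (hx : ∀ n, |x (n + 1) - l * x n| ≤ C * m ^ n) :
    ∃ L, Tendsto (fun n => x n / l ^ n) atTop (𝓝 L) := by
  have hl0 : 0 < l := by linarith
  apply cauchySeq_tendsto_of_complete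
  refine cauchySeq_of_le_geometric (m / l) (C / l) ((div_lt_one hl0).2 hml) fun n => ?_
  rw [dist_comm, Real.dist_eq]
  have h : x (n + 1) / l ^ (n + 1) - x n / l ^ n = (x (n + 1) - l * x n) / l ^ (n + 1) := by
    field_simp
    ring
  rw [h, abs_div, abs_of_pos (pow_pos hl0 _), div_pow, div_mul_div_comm, ← pow_succ']
  gcongr
  exact hx n

/-- If `Λ_{n+1} - (d+2) Λ_n + Λ_{n-1} = Δ_n` for `n ≥ 2`, with `d ≥ 1` an integer and
`Δ_n = O(ν^n)` for some `0 < ν < λ = (d + 2 + √(d(d+4)))/2`, then `Λ_n / λ^n` converges to a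
finite limit as `n → ∞`. -/
theorem lambda_over_lam_pow_converges
    (d : ℕ) (hd : 1 ≤ d)
    (Λ Δ : ℕ → ℝ)
    (hrec : ∀ n, 2 ≤ n →
      Λ (n + 1) - ((d : ℝ) + 2) * Λ n + Λ (n - 1) = Δ n)
    (ν : ℝ) (hν0 : 0 < ν) (hνlam : ν < ((d : ℝ) + 2 + Real.sqrt (d * (d + 4))) / 2)
    (hΔ : ∃ K : ℝ, ∃ N : ℕ, ∀ n, N ≤ n → |Δ n| ≤ K * ν ^ n) :
    ∃ L : ℝ, Tendsto
      (fun n : ℕ => Λ n / (((d : ℝ) + 2 + Real.sqrt (d * (d + 4))) / 2) ^ n)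
      atTop (𝓝 L) := by
  set l : ℝ := ((d : ℝ) + 2 + Real.sqrt (d * (d + 4))) / 2 with hl_def
  have hd0 : (1 : ℝ) ≤ d := by exact_mod_cast hd
  have hsqrt : Real.sqrt (d * (d + 4)) ^ 2 = (d : ℝ) * (d + 4) := Real.sq_sqrt (by positivity)
  have hl1 : 1 < l := by
    have := Real.sqrt_nonneg ((d : ℝ) * (d + 4))
    rw [hl_def]; linarith
  have hl0 : 0 < l := by linarith
  have hchar : (d : ℝ) + 2 = l + 1 / l := by
    have h : l ^ 2 = (d + 2) * l - 1 := by rw [hl_def]; linear_combination hsqrt / 4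
    field_simp
    linarith
  obtain ⟨K, N, hK⟩ := hΔ
  set m := max ν 1
  have hm1 : 1 ≤ m := le_max_right _ _
  have hml : m < l := max_lt hνlam hl1
  set M := N + 2
  obtain ⟨C, hC⟩ := exists_abs_le_mul_pow_of_contracting
    (w := fun n => Λ (n + M + 1) - l * Λ (n + M)) (e := fun n => Δ (n + M + 1))
    (A := |K| * m ^ M) hl1 hm1 (by positivity)
    (fun n => by
      have h := hrec (n + M + 1) (by omega)
      rw [Nat.add_sub_cancel, hchar] at h
      have hn : n + 1 + M = n + M + 1 := by omega
      simp only [hn]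
      rw [← h]
      field_simp
      ring)
    (fun n => by
      calc |Δ (n + M + 1)| ≤ K * ν ^ (n + M + 1) := hK _ (by omega)
        _ ≤ |K| * m ^ (n + M + 1) := by
          gcongr
          · exact le_abs_self K
          · exact le_max_left _ _
        _ = |K| * m ^ M * m ^ (n + 1) := by ring)
  obtain ⟨L, hL⟩ := exists_tendsto_div_pow_of_abs_sub_le (x := fun n => Λ (n + M))
    (by linarith) hml (fun n => by
      have hn : n + 1 + M = n + M + 1 := by omega
      simp only [hn]
      exact hC n)
  refine ⟨L / l ^ M, (tendsto_add_atTop_iff_nat M).1 ?_⟩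
  refine (hL.div_const (l ^ M)).congr fun n => ?_
  rw [div_div, ← pow_add]
end

section
/- Let d ≥ 1 be an integer, λ = (d + 2 + √(d(d+4)))/2, and let ν > λ and C' > 0 be real. Suppose (Λ_n)_{n≥1} and (Δ_n)_{n≥2} are real sequences satisfying Λ_{n+1} − (d+2)·Λ_n + Λ_{n−1} = Δ_n for all n ≥ 2 and Δ_n/ν^n → C' as n → ∞. Then Λ_n/ν^n → C as n → ∞, where C = C'/(ν − (d+2) + ν^{−1}), and C > 0. -/
open Filter Topology

/-- Solutions of `x (n + 1) = r * x n + e n` with `0 ≤ r < 1` tend to `0` when `e` does. -/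
theorem tendsto_zero_of_eventually_linear_recurrence {r : ℝ} (hr0 : 0 ≤ r) (hr1 : r < 1)
    {x e : ℕ → ℝ} (h : ∀ᶠ n in atTop, x (n + 1) = r * x n + e n)
    (he : Tendsto e atTop (𝓝 0)) : Tendsto x atTop (𝓝 0) := by
  rw [Metric.tendsto_atTop]
  intro ε hε
  have hδ : 0 < ε / 2 * (1 - r) := mul_pos (half_pos hε) (sub_pos.2 hr1)
  obtain ⟨N, hN⟩ := eventually_atTop.1 (h.and (Metric.tendsto_nhds.1 he _ hδ))
  have key : ∀ k, |x (N + k)| ≤ r ^ k * |x N| + ε / 2 := by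
    intro k
    induction k with
    | zero => simpa using (half_pos hε).le
    | succ k ih =>
      obtain ⟨h1, h2⟩ := hN (N + k) (Nat.le_add_right _ _)
      rw [Real.dist_eq, sub_zero] at h2
      have h3 : |x (N + (k + 1))| ≤ r * |x (N + k)| + |e (N + k)| := by
        rw [← add_assoc, h1]
        exact (abs_add_le _ _).trans_eq (by rw [abs_mul, abs_of_nonneg hr0])
      calc |x (N + (k + 1))| ≤ r * (r ^ k * |x N| + ε / 2) + ε / 2 * (1 - r) :=
            h3.trans (add_le_add (mul_le_mul_of_nonneg_left ih hr0) h2.le)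
        _ = r ^ (k + 1) * |x N| + ε / 2 := by ring
  have hpow : Tendsto (fun k : ℕ => r ^ k * |x N|) atTop (𝓝 0) := by
    simpa using (tendsto_pow_atTop_nhds_zero_of_lt_one hr0 hr1).mul_const |x N|
  obtain ⟨K, hK⟩ := eventually_atTop.1 (hpow.eventually_lt_const (half_pos hε))
  refine ⟨N + K, fun n hn => ?_⟩
  obtain ⟨k, rfl⟩ := Nat.exists_eq_add_of_le ((Nat.le_add_right N K).trans hn)
  rw [Real.dist_eq, sub_zero]
  linarith [key k, hK k (by omega)]

/-- Solutions of `x (n + 1) = r * x n + e n` with `0 ≤ r < 1` tend to `L / (1 - r)` when `e`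
tends to `L`. -/
theorem tendsto_of_eventually_linear_recurrence {r L : ℝ} (hr0 : 0 ≤ r) (hr1 : r < 1)
    {x e : ℕ → ℝ} (h : ∀ᶠ n in atTop, x (n + 1) = r * x n + e n)
    (he : Tendsto e atTop (𝓝 L)) : Tendsto x atTop (𝓝 (L / (1 - r))) := by
  have hr : 1 - r ≠ 0 := (sub_pos.2 hr1).ne'
  rw [← tendsto_sub_nhds_zero_iff] at he ⊢
  refine tendsto_zero_of_eventually_linear_recurrence hr0 hr1 (h.mono fun n hn => ?_) he
  rw [hn]
  field_simp
  ring

/-- If `Λ_{n+1} - (d+2) Λ_n + Λ_{n-1} = Δ_n` for `n ≥ 2`, with `d ≥ 1` an integer,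
`λ = (d + 2 + √(d(d+4)))/2`, `ν > λ`, `C' > 0` and `Δ_n / ν^n → C'`, then
`Λ_n / ν^n → C = C'/(ν - (d+2) + ν⁻¹)`, and `C > 0`. -/
theorem lambda_asymptotics_dominant_inhomogeneity
    (d : ℕ) (hd : 1 ≤ d)
    (ν C' : ℝ) (hν : ((d : ℝ) + 2 + Real.sqrt (d * (d + 4))) / 2 < ν) (hC' : 0 < C')
    (Λ Δ : ℕ → ℝ)
    (hrec : ∀ n, 2 ≤ n →
      Λ (n + 1) - ((d : ℝ) + 2) * Λ n + Λ (n - 1) = Δ n)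
    (hΔ : Tendsto (fun n : ℕ => Δ n / ν ^ n) atTop (𝓝 C')) :
    0 < C' / (ν - ((d : ℝ) + 2) + ν⁻¹) ∧
    Tendsto (fun n : ℕ => Λ n / ν ^ n) atTop
      (𝓝 (C' / (ν - ((d : ℝ) + 2) + ν⁻¹))) := by
  set t := Real.sqrt (d * (d + 4)) with ht
  have hd' : (1 : ℝ) ≤ d := by exact_mod_cast hd
  have ht0 : 0 ≤ t := Real.sqrt_nonneg _
  have ht2 : t ^ 2 = d * (d + 4) := Real.sq_sqrt (by positivity)
  have htd : t < d + 2 := by nlinarith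
  obtain ⟨lam, hlam⟩ : ∃ lam, lam = ((d : ℝ) + 2 + t) / 2 := ⟨_, rfl⟩
  obtain ⟨mu, hmu⟩ : ∃ mu, mu = ((d : ℝ) + 2 - t) / 2 := ⟨_, rfl⟩
  rw [← hlam] at hν
  have hmu0 : 0 < mu := by linarith
  have hmulam : mu ≤ lam := by linarith
  have hsum : (d : ℝ) + 2 = lam + mu := by linarith
  have hprod : lam * mu = 1 := by rw [hlam, hmu]; linear_combination -ht2 / 4
  have hν0 : 0 < ν := by linarith
  have hden : ν - ((d : ℝ) + 2) + ν⁻¹ = ν * (1 - lam / ν) * (1 - mu / ν) := by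
    rw [hsum]
    field_simp
    linear_combination -hprod
  have hp1 : lam / ν < 1 := (div_lt_one hν0).2 hν
  have hq1 : mu / ν < 1 := (div_lt_one hν0).2 (hmulam.trans_lt hν)
  have hp0 : 0 ≤ lam / ν := div_nonneg (hmu0.le.trans hmulam) hν0.le
  have hq0 : 0 ≤ mu / ν := div_nonneg hmu0.le hν0.le
  rw [hden]
  refine ⟨div_pos hC' (mul_pos (mul_pos hν0 (sub_pos.2 hp1)) (sub_pos.2 hq1)), ?_⟩
  have hu : Tendsto (fun n => Λ (n + 1) / ν ^ (n + 1) - mu / ν * (Λ n / ν ^ n)) atTop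
      (𝓝 (C' / ν / (1 - lam / ν))) := by
    refine tendsto_of_eventually_linear_recurrence hp0 hp1
      ((eventually_ge_atTop 1).mono fun n hn => ?_)
      (((tendsto_add_atTop_iff_nat 1).2 hΔ).div_const ν)
    have h := hrec (n + 1) (by omega)
    rw [Nat.add_sub_cancel, hsum] at h
    rw [← h]
    simp only [pow_succ]
    field_simp
    linear_combination Λ n * hprod
  rw [← div_div, ← div_div]
  exact tendsto_of_eventually_linear_recurrence hq0 hq1
    (Eventually.of_forall fun n => by ring) hu
end

section
/- Let n ≥ 2, let a_0 ∈ ℤ and a_1, …, a_n be positive integers with a_n ≥ 2, and let p_n/q_n = [a_0; a_1, …, a_n] in lowest terms with q_n > 0. Then for every integer z ≥ 2, the finite continued fraction [a_0; a_1, …, a_n, z−1, 1, a_n−1, a_{n−1}, …, a_2, a_1] has value p_n/q_n + (−1)^n/(z·q_n²). -/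
/-- The value of a finite continued fraction `[a_0; a_1, …, a_n]`, given as the list
`[a_0, a_1, …, a_n]`, as a rational number. -/
def cfVal : List ℤ → ℚ
  | [] => 0
  | [a] => (a : ℚ)
  | a :: b :: l => (a : ℚ) + 1 / cfVal (b :: l)

/-- The sequence with initial values `u, v` and `s (k + 2) = a k * s (k + 1) + s k`.
With initial values `0, 1` and `1, 0` it gives the numerators and denominators of the convergents
of `[a 0; a 1, …]`, shifted by two. -/
def convergentSeq (a : ℕ → ℤ) (u v : ℤ) : ℕ → ℤ
  | 0 => u
  | 1 => v
  | k + 2 => a k * convergentSeq a u v (k + 1) + convergentSeq a u v k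

theorem cfVal_cons (a : ℤ) {l : List ℤ} (hl : l ≠ []) :
    cfVal (a :: l) = a + 1 / cfVal l := by
  cases l with
  | nil => exact absurd rfl hl
  | cons b l => rfl

theorem convergentSeq_det (a : ℕ → ℤ) (k : ℕ) :
    convergentSeq a 0 1 k * convergentSeq a 1 0 (k + 1)
      - convergentSeq a 0 1 (k + 1) * convergentSeq a 1 0 k = (-1) ^ (k + 1) := by
  induction k with
  | zero => simp [convergentSeq]
  | succ k ih =>
    rw [pow_succ, ← ih]
    simp only [convergentSeq]
    ring

theorem convergentSeq_den_pos {a : ℕ → ℤ} {n : ℕ} (ha : ∀ j, 1 ≤ j → j ≤ n → 1 ≤ a j) :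
    ∀ k ≤ n, 0 < convergentSeq a 1 0 (k + 2) ∧ 0 ≤ convergentSeq a 1 0 (k + 1) := by
  intro k
  induction k with
  | zero => simp [convergentSeq]
  | succ k ih =>
    intro hk
    obtain ⟨h1, h2⟩ := ih (by omega)
    refine ⟨?_, h1.le⟩
    have h3 := ha (k + 1) (by omega) hk
    have h4 : convergentSeq a 1 0 (k + 1 + 2)
        = a (k + 1) * convergentSeq a 1 0 (k + 2) + convergentSeq a 1 0 (k + 1) := rfl
    rw [h4]
    positivity

theorem cfVal_map_range_append {a : ℕ → ℤ} {n : ℕ} (ha : ∀ j, 1 ≤ j → j ≤ n → 1 ≤ a j) :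
    ∀ k ≤ n, ∀ l ≠ [], 0 < cfVal l →
      cfVal ((List.range (k + 1)).map a ++ l)
        = (convergentSeq a 0 1 (k + 2) * cfVal l + convergentSeq a 0 1 (k + 1))
          / (convergentSeq a 1 0 (k + 2) * cfVal l + convergentSeq a 1 0 (k + 1)) := by
  intro k
  induction k with
  | zero =>
    intro _ l hl hx
    have : cfVal ((List.range (0 + 1)).map a ++ l) = cfVal (a 0 :: l) := by simp
    rw [this, cfVal_cons _ hl]
    simp [convergentSeq]
    field_simp
  | succ k ih =>
    intro hk l hl hx
    have h3 : (1 : ℚ) ≤ a (k + 1) := mod_cast ha (k + 1) (by omega) hk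
    have h5 : cfVal (a (k + 1) :: l) = a (k + 1) + 1 / cfVal l := cfVal_cons _ hl
    have hy : 0 < cfVal (a (k + 1) :: l) := by
      rw [h5]
      positivity
    have hcat : (List.range (k + 1 + 1)).map a ++ l
        = (List.range (k + 1)).map a ++ (a (k + 1) :: l) := by
      rw [List.range_succ]
      simp
    have h4 (u v : ℤ) : convergentSeq a u v (k + 1 + 2)
        = a (k + 1) * convergentSeq a u v (k + 2) + convergentSeq a u v (k + 1) := rfl
    rw [hcat, ih (by omega) _ (by simp) hy, h5, h4, h4, ← mul_div_mul_right _ _ hx.ne']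
    push_cast
    congr 1 <;> field_simp <;> ring

theorem cfVal_reverse_map_range' {a : ℕ → ℤ} {n : ℕ} (ha : ∀ j, 1 ≤ j → j ≤ n → 1 ≤ a j) :
    ∀ k, k + 1 ≤ n →
      cfVal ((List.range' 1 (k + 1)).map a).reverse
        = convergentSeq a 1 0 (k + 3) / convergentSeq a 1 0 (k + 2) := by
  intro k
  induction k with
  | zero => simp [convergentSeq, cfVal]
  | succ k ih =>
    intro hk
    have hcat : ((List.range' 1 (k + 1 + 1)).map a).reverse
        = a (k + 2) :: ((List.range' 1 (k + 1)).map a).reverse := by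
      rw [List.range'_concat]
      simp [add_left_comm]
    have h4 : convergentSeq a 1 0 (k + 1 + 3)
        = a (k + 2) * convergentSeq a 1 0 (k + 3) + convergentSeq a 1 0 (k + 2) := rfl
    have h6 : (0 : ℚ) < convergentSeq a 1 0 (k + 3) :=
      mod_cast (convergentSeq_den_pos ha (k + 1) (by omega)).1
    rw [hcat, cfVal_cons _ (by simp), ih (by omega), h4]
    push_cast
    field_simp

/-- **Lemma 4.1** (folding lemma).  Let `p_n/q_n = [a_0; a_1, …, a_n]` be in lowest terms with
`n ≥ 2`, `a_j ≥ 1` for `1 ≤ j ≤ n`, `a_n ≥ 2` and `q_n > 0`.  Then for every `z ≥ 2`,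
`[a_0; a_1, …, a_n, z-1, 1, a_n - 1, a_{n-1}, …, a_2, a_1] = p_n/q_n + (-1)^n/(z q_n²)`. -/
theorem folding_transformation_value
    (n : ℕ) (hn : 2 ≤ n) (a : ℕ → ℤ)
    (ha : ∀ j, 1 ≤ j → j ≤ n → 1 ≤ a j) (han : 2 ≤ a n)
    (p q : ℤ) (hq : 0 < q) (hcop : Int.gcd p q = 1)
    (hval : (p : ℚ) / (q : ℚ) = cfVal ((List.range (n + 1)).map a)) :
    ∀ z : ℤ, 2 ≤ z →
      cfVal (((List.range (n + 1)).map a) ++ [z - 1, 1, a n - 1]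
          ++ ((List.range' 1 (n - 1)).map a).reverse)
        = (p : ℚ) / (q : ℚ) + (-1 : ℚ) ^ n / ((z : ℚ) * (q : ℚ) ^ 2) := by
  intro z hz
  obtain ⟨m, rfl⟩ : ∃ m, n = m + 2 := ⟨n - 2, by omega⟩
  have hQ : 0 < convergentSeq a 1 0 (m + 4) := (convergentSeq_den_pos ha (m + 2) le_rfl).1
  have hR : 0 < convergentSeq a 1 0 (m + 3) := (convergentSeq_den_pos ha (m + 1) (by omega)).1
  have hS : 0 < convergentSeq a 1 0 (m + 2) := (convergentSeq_den_pos ha m (by omega)).1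
  have hdet := convergentSeq_det a (m + 3)
  have hrec (u v : ℤ) : convergentSeq a u v (m + 4)
      = a (m + 2) * convergentSeq a u v (m + 3) + convergentSeq a u v (m + 2) := rfl
  have hpq : (p : ℚ) / q = convergentSeq a 0 1 (m + 4) / convergentSeq a 1 0 (m + 4) := by
    have hx : (0 : ℚ) < cfVal [a (m + 2)] := by
      simp only [cfVal]
      exact_mod_cast (by omega : 0 < a (m + 2))
    rw [hval, List.range_succ, List.map_append,
      show List.map a [m + 2] = [a (m + 2)] from rfl,
      cfVal_map_range_append ha (m + 1) (by omega) _ (by simp) hx, hrec, hrec]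
    simp only [cfVal]
    push_cast
    ring
  have hcopPQ : Int.gcd (convergentSeq a 0 1 (m + 4)) (convergentSeq a 1 0 (m + 4)) = 1 := by
    rw [← Int.isCoprime_iff_gcd_eq_one]
    refine ⟨-(-1) ^ (m + 4) * convergentSeq a 1 0 (m + 3),
      (-1) ^ (m + 4) * convergentSeq a 0 1 (m + 3), ?_⟩
    have h1 : ((-1 : ℤ) ^ (m + 4)) * (-1) ^ (m + 4) = 1 := by
      rw [← mul_pow]
      simp
    linear_combination (-1) ^ (m + 4) * hdet + h1
  obtain ⟨hp, hq'⟩ := Rat.div_int_inj hq hQ hcop hcopPQ hpq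
  rw [hp, hq']
  have htail : cfVal ((a (m + 2) - 1) :: ((List.range' 1 (m + 1)).map a).reverse)
      = (convergentSeq a 1 0 (m + 4) - convergentSeq a 1 0 (m + 3))
        / convergentSeq a 1 0 (m + 3) := by
    have hR' : (convergentSeq a 1 0 (m + 3) : ℚ) ≠ 0 := mod_cast hR.ne'
    rw [cfVal_cons _ (by simp), cfVal_reverse_map_range' ha m (by omega), hrec]
    push_cast
    field_simp
    ring
  have hlt : convergentSeq a 1 0 (m + 3) < convergentSeq a 1 0 (m + 4) := by
    rw [hrec]
    nlinarith
  have hltQ : (convergentSeq a 1 0 (m + 3) : ℚ) < convergentSeq a 1 0 (m + 4) := mod_cast hlt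
  have hRQ : (0 : ℚ) < convergentSeq a 1 0 (m + 3) := mod_cast hR
  have hQQ : (0 : ℚ) < convergentSeq a 1 0 (m + 4) := mod_cast hQ
  have hzQ : (2 : ℚ) ≤ z := mod_cast hz
  have hdetQ : (convergentSeq a 0 1 (m + 3) : ℚ) * convergentSeq a 1 0 (m + 4)
      - convergentSeq a 0 1 (m + 4) * convergentSeq a 1 0 (m + 3) = (-1) ^ (m + 4) :=
    mod_cast hdet
  have hx : cfVal ((z - 1) :: 1 :: (a (m + 2) - 1) :: ((List.range' 1 (m + 1)).map a).reverse)
      = z - convergentSeq a 1 0 (m + 3) / convergentSeq a 1 0 (m + 4) := by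
    have hsub : (convergentSeq a 1 0 (m + 4) : ℚ) - convergentSeq a 1 0 (m + 3) ≠ 0 := by
      linarith
    rw [cfVal_cons _ (by simp), cfVal_cons _ (by simp), htail]
    have h1 : ((1 : ℤ) : ℚ) + 1 / ((convergentSeq a 1 0 (m + 4) - convergentSeq a 1 0 (m + 3))
        / convergentSeq a 1 0 (m + 3)) = convergentSeq a 1 0 (m + 4)
          / (convergentSeq a 1 0 (m + 4) - convergentSeq a 1 0 (m + 3)) := by
      push_cast
      field_simp
      ring
    rw [h1]
    push_cast
    field_simp
    ring
  have hxpos : (0 : ℚ) < z - convergentSeq a 1 0 (m + 3) / convergentSeq a 1 0 (m + 4) := by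
    have : (convergentSeq a 1 0 (m + 3) : ℚ) / convergentSeq a 1 0 (m + 4) < 1 :=
      (div_lt_one hQQ).2 hltQ
    linarith
  have hcat := cfVal_map_range_append ha (m + 2) le_rfl
    ((z - 1) :: 1 :: (a (m + 2) - 1) :: ((List.range' 1 (m + 1)).map a).reverse) (by simp)
    (by rw [hx]; exact hxpos)
  rw [hx] at hcat
  rw [List.append_assoc]
  refine hcat.trans ?_
  have hden : (convergentSeq a 1 0 (m + 4) : ℚ)
      * (z - convergentSeq a 1 0 (m + 3) / convergentSeq a 1 0 (m + 4))
        + convergentSeq a 1 0 (m + 3) = z * convergentSeq a 1 0 (m + 4) := by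
    field_simp
    ring
  have hpow : (-1 : ℚ) ^ (m + 4) = (-1) ^ (m + 2) := by ring
  rw [hden, ← hpow, ← hdetQ]
  field_simp
  ring
end
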